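/- Let N ≥ 1, m ≥ 1, and N/(N+m) < p ≤ min{1, N/m}; set p* := Np/(N−mp) if mp < N and p* := ∞ if mp = N, and let α ∈ [1, p*). Then there exists a constant C > 0 such that for every f ∈ C_c^∞(ℝ^N) there exists a family of polynomials P_{x,t,f} of degree at most m−1, indexed by x ∈ ℝ^N and 0 < t < 1 and depending continuously on (x,t,y), such that ∫_{ℝ^N} [ sup_{0<t<1} ⨍_{B(x,t)} ( t^{−m} |f(y) − P_{x,t,f}(y)| )^α dy ]^{p/α} dx ≤ C ‖f‖_{h^{m,p}}^p. -/

import Mathlib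

open MeasureTheory Set Metric Filter
open scoped ENNReal NNReal Topology

noncomputable section

abbrev RN (N : ℕ) := EuclideanSpace ℝ (Fin N)

variable {N : ℕ}

/-- Partial derivative in the `i`-th coordinate direction. -/
def pd {E : Type*} [NormedAddCommGroup E] [NormedSpace ℝ E] (i : Fin N)
    (f : RN N → E) : RN N → E :=
  fun x => fderiv ℝ f x (EuclideanSpace.single i 1)

/-- Multi-index partial derivative `∂^α`. -/
def md {E : Type*} [NormedAddCommGroup E] [NormedSpace ℝ E] (α : Fin N → ℕ)
    (f : RN N → E) : RN N → E :=
  ((List.ofFn fun i : Fin N => (pd i)^[α i]).foldr (· ∘ ·) id) f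

/-- Order `|α|` of a multi-index. -/
def mOrder (α : Fin N → ℕ) : ℕ := ∑ i, α i

/-- Multi-indices of order at most `k`. -/
def idxLe (N k : ℕ) : Finset (Fin N → ℕ) :=
  (Fintype.piFinset fun _ : Fin N => Finset.range (k + 1)).filter fun α => mOrder α ≤ k

/-- Multi-indices of order exactly `k`. -/
def idxEq (N k : ℕ) : Finset (Fin N → ℕ) :=
  (Fintype.piFinset fun _ : Fin N => Finset.range (k + 1)).filter fun α => mOrder α = k

/-- The dilate `φ_t(z) = t^{-N} φ(z/t)`. -/
def dil (φ : RN N → ℝ) (t : ℝ) (z : RN N) : ℝ := φ (t⁻¹ • z) / t ^ N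

/-- Convolution `(u * φ_t)(x)`. -/
def convAt (φ : RN N → ℝ) (t : ℝ) (u : RN N → ℂ) (x : RN N) : ℂ :=
  ∫ y, dil φ t (x - y) • u y

/-- The small maximal function `sup_{0<t<1} |(u * φ_t)(x)|`. -/
def smallMax (φ : RN N → ℝ) (u : RN N → ℂ) (x : RN N) : ℝ≥0∞ :=
  ⨆ t ∈ Ioo (0 : ℝ) 1, ENNReal.ofReal ‖convAt φ t u x‖

/-- The localizable Hardy space quasi-norm `‖u‖_{h^p}` (for `0 < p < ∞`). -/
def hNorm (φ : RN N → ℝ) (p : ℝ) (u : RN N → ℂ) : ℝ≥0∞ :=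
  (∫⁻ x, smallMax φ u x ^ p) ^ (1 / p)

/-- A fixed radial nonnegative smooth function supported in the unit ball with integral 1. -/
structure GoodPhi (φ : RN N → ℝ) : Prop where
  smooth : ContDiff ℝ (⊤ : ℕ∞) φ
  nonneg : ∀ x, 0 ≤ φ x
  radial : ∀ x y : RN N, ‖x‖ = ‖y‖ → φ x = φ y
  supp : tsupport φ ⊆ closedBall 0 1
  int_one : ∫ x, φ x = 1

/-- The closed axes-parallel cube with center `c` and side length `ℓ`. -/
def cube (c : RN N) (ℓ : ℝ) : Set (RN N) := {y | ∀ i, |y i - c i| ≤ ℓ / 2}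

/-- The open axes-parallel cube with center `c` and side length `ℓ`
(the interior of `cube c ℓ` when `ℓ > 0`). -/
def openCube (c : RN N) (ℓ : ℝ) : Set (RN N) := {y | ∀ i, |y i - c i| < ℓ / 2}

/-- `P` is a (complex) polynomial in `N` variables of degree at most `d`. -/
def IsPolyDegLE (N d : ℕ) (P : RN N → ℂ) : Prop :=
  ∃ c : (Fin N → ℕ) → ℂ, ∀ x : RN N, P x = ∑ α ∈ idxLe N d, c α * ∏ i, ((x i : ℝ) : ℂ) ^ α i

open scoped Convolution

/-- Smooth compactly supported complex functions on `ℝ^N`. -/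
def TestFn (N : ℕ) : Submodule ℂ (RN N → ℂ) where
  carrier := {u | ContDiff ℝ (⊤ : ℕ∞) u ∧ HasCompactSupport u}
  add_mem' := fun ha hb => ⟨ha.1.add hb.1, ha.2.add hb.2⟩
  zero_mem' := ⟨contDiff_const, HasCompactSupport.zero⟩
  smul_mem' := fun c _ hu => ⟨contDiff_const.smul hu.1, hu.2.smul_left (f := fun _ => c)⟩

namespace TestFn

instance : CoeFun (TestFn N) fun _ => RN N → ℂ := ⟨Subtype.val⟩

theorem smooth (u : TestFn N) : ContDiff ℝ (⊤ : ℕ∞) u := u.2.1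

theorem compact (u : TestFn N) : HasCompactSupport u := u.2.2

theorem continuous (u : TestFn N) : Continuous u := (smooth u).continuous

theorem differentiable (u : TestFn N) : Differentiable ℝ u :=
  (smooth u).differentiable (by simp)

theorem integrable (u : TestFn N) : Integrable u :=
  (continuous u).integrable_of_hasCompactSupport (compact u)

theorem exists_bound (u : TestFn N) : ∃ B : ℝ, 0 ≤ B ∧ ∀ x, ‖u x‖ ≤ B := by
  obtain ⟨B, hB⟩ := (compact u).exists_bound_of_continuous (continuous u)
  exact ⟨B, (norm_nonneg _).trans (hB 0), hB⟩

/-- The partial derivative as an operator on test functions. -/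
def D (i : Fin N) : Module.End ℂ (TestFn N) where
  toFun u := ⟨pd i u, by
    refine ⟨?_, ?_⟩
    · exact ((smooth u).fderiv_right (m := (⊤ : ℕ∞)) (by simp)).clm_apply contDiff_const
    · exact (compact u).fderiv_apply (𝕜 := ℝ) _⟩
  map_add' u v := by
    ext x
    simp [pd, fderiv_add ((differentiable u) x) ((differentiable v) x)]
  map_smul' c u := by
    ext x
    simp [pd, fderiv_const_smul ((differentiable u) x) c]

theorem coe_D (i : Fin N) (u : TestFn N) : (D i u : RN N → ℂ) = pd i u := rfl

theorem D_comm (i j : Fin N) : Commute (D i) (D j) := by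
  ext u x
  have h2 : Differentiable ℝ (fderiv ℝ u) :=
    ((smooth u).fderiv_right (m := (⊤ : ℕ∞)) (by simp)).differentiable (by simp)
  have hs := ((smooth u).contDiffAt (x := x)).isSymmSndFDerivAt
    (by simpa using WithTop.coe_le_coe.2 (le_top (a := (2 : ℕ∞))))
  have key : ∀ a b : RN N, fderiv ℝ (fun y => fderiv ℝ u y a) x b = fderiv ℝ (fderiv ℝ u) x b a := by
    intro a b
    rw [fderiv_clm_apply (h2 x) (differentiableAt_const a)]
    simp
  change fderiv ℝ (fun y => fderiv ℝ u y _) x _ = fderiv ℝ (fun y => fderiv ℝ u y _) x _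
  rw [key, key, hs]

/-- Convolution of test functions. -/
def conv (u v : TestFn N) : TestFn N :=
  ⟨(u : RN N → ℂ) ⋆[ContinuousLinearMap.mul ℝ ℂ, volume] (v : RN N → ℂ),
    (compact v).contDiff_convolution_right _ (continuous u).locallyIntegrable (smooth v),
    (compact u).convolution _ (compact v)⟩

theorem conv_apply (u v : TestFn N) (x : RN N) : conv u v x = ∫ y, u y * v (x - y) := rfl

theorem conv_comm (u v : TestFn N) : conv u v = conv v u := by
  ext x
  rw [conv_apply, conv_apply, ← integral_sub_left_eq_self _ volume x]
  simp [mul_comm]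

theorem conv_apply' (u v : TestFn N) (x : RN N) : conv u v x = ∫ y, u (x - y) * v y := by
  rw [conv_comm, conv_apply]; simp [mul_comm]

theorem integrable_conv (u v : TestFn N) (x : RN N) : Integrable fun y => u y * v (x - y) := by
  refine Continuous.integrable_of_hasCompactSupport ?_ ((compact u).mul_right)
  exact (continuous u).mul ((continuous v).comp (by fun_prop))

theorem conv_assoc (u v w : TestFn N) : conv (conv u v) w = conv u (conv v w) := by
  ext x
  have hn : ∀ a : TestFn N, HasCompactSupport fun x => ‖a x‖ := fun a => (compact a).norm
  refine convolution_assoc (ContinuousLinearMap.mul ℝ ℂ) (ContinuousLinearMap.mul ℝ ℂ)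
    (ContinuousLinearMap.mul ℝ ℂ) (ContinuousLinearMap.mul ℝ ℂ)
    (fun a b c => by simp [mul_assoc]) (continuous u).aestronglyMeasurable
    (continuous v).aestronglyMeasurable (continuous w).aestronglyMeasurable ?_ ?_ ?_
  · exact Eventually.of_forall fun y => integrable_conv u v y
  · refine Eventually.of_forall fun y => ?_
    exact (hn w).convolutionExists_right _ (continuous v).norm.locallyIntegrable (continuous w).norm y
  · refine HasCompactSupport.convolutionExists_right _ ?_ (continuous u).norm.locallyIntegrable ?_ x
    · exact (hn v).convolution _ (hn w)
    · exact (hn w).continuous_convolution_right _ (continuous v).norm.locallyIntegrable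
        (continuous w).norm

/-- Convolution as a bilinear map. -/
def cv : TestFn N →ₗ[ℂ] Module.End ℂ (TestFn N) :=
  LinearMap.mk₂ ℂ conv
    (fun u u' v => by
      ext x
      simp only [conv_apply, Submodule.coe_add, Pi.add_apply, add_mul]
      exact integral_add (integrable_conv u v x) (integrable_conv u' v x))
    (fun c u v => by
      ext x
      simp only [conv_apply, SetLike.val_smul, Pi.smul_apply, smul_eq_mul, mul_assoc]
      exact integral_const_mul _ _)
    (fun u v v' => by
      ext x
      simp only [conv_apply, Submodule.coe_add, Pi.add_apply, mul_add]
      exact integral_add (integrable_conv u v x) (integrable_conv u v' x))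
    (fun c u v => by
      ext x
      simp only [conv_apply, SetLike.val_smul, Pi.smul_apply, smul_eq_mul, mul_left_comm]
      exact integral_const_mul _ _)

theorem cv_apply (u v : TestFn N) : cv u v = conv u v := rfl

theorem cv_comm (u v : TestFn N) : Commute (cv u) (cv v) := by
  refine LinearMap.ext fun w => ?_
  change conv u (conv v w) = conv v (conv u w)
  rw [← conv_assoc, conv_comm u v, conv_assoc]

theorem D_conv (i : Fin N) (u v : TestFn N) : D i (conv u v) = conv u (D i v) := by
  ext x
  have h := (compact v).hasFDerivAt_convolution_right (ContinuousLinearMap.mul ℝ ℂ)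
    (continuous u).locallyIntegrable ((smooth v).of_le (by simp)) x (μ := volume)
  change fderiv ℝ _ x _ = _
  rw [conv, h.fderiv, conv_apply, convolution_precompR_apply]
  · rfl
  · exact (continuous u).locallyIntegrable
  · exact (compact v).fderiv ℝ
  · exact (smooth v).continuous_fderiv (by simp)

theorem D_cv_comm (i : Fin N) (u : TestFn N) : Commute (D i) (cv u) :=
  LinearMap.ext fun w => D_conv i u w

/-- Iterated partial derivative along a word. -/
def DW (w : List (Fin N)) : Module.End ℂ (TestFn N) := (w.map D).prod

theorem DW_cons (i : Fin N) (w : List (Fin N)) : DW (i :: w) = D i * DW w := by simp [DW]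

theorem DW_comm_of (w : List (Fin N)) (T : Module.End ℂ (TestFn N)) (h : ∀ i, Commute (D i) T) :
    Commute (DW w) T := by
  induction w with
  | nil => simp [DW]
  | cons i w ih => rw [DW_cons]; exact (h i).mul_left ih

theorem DW_cons_apply (i : Fin N) (w : List (Fin N)) (u : TestFn N) :
    DW (i :: w) u = DW w (D i u) := by
  have := DW_comm_of w (D i) (fun j => D_comm j i)
  rw [DW_cons, ← this.eq]; rfl

theorem exists_DW_bound (k : ℕ) (u : TestFn N) :
    ∃ B : ℝ, 0 ≤ B ∧ ∀ w : List (Fin N), w.length = k → ∀ x, ‖DW w u x‖ ≤ B := by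
  induction k generalizing u with
  | zero =>
    obtain ⟨B, hB, h⟩ := (exists_bound u)
    refine ⟨B, hB, fun w hw => ?_⟩
    rw [List.length_eq_zero_iff] at hw
    subst hw
    exact h
  | succ k ih =>
    choose B hB h using fun i => ih (D i u)
    refine ⟨∑ i, B i, Finset.sum_nonneg fun i _ => hB i, fun w hw x => ?_⟩
    obtain ⟨i, w, rfl⟩ := List.exists_cons_of_length_eq_add_one hw
    rw [DW_cons_apply]
    refine (h i w (by simpa using hw) x).trans ?_
    exact Finset.single_le_sum (fun i _ => hB i) (Finset.mem_univ i)

end TestFn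

namespace GoodPhi

variable {φ : RN N → ℝ}

theorem eq_zero (hφ : GoodPhi φ) {z : RN N} (hz : 1 < ‖z‖) : φ z = 0 := by
  by_contra h
  have := hφ.supp (subset_tsupport φ h)
  simp at this
  linarith

end GoodPhi

section Dilates

variable {φ : RN N → ℝ} {t : ℝ}

theorem dil_nonneg (hφ : GoodPhi φ) (ht : 0 < t) (z : RN N) : 0 ≤ dil φ t z :=
  div_nonneg (hφ.nonneg _) (by positivity)

theorem dil_eq_zero (hφ : GoodPhi φ) (ht : 0 < t) {z : RN N} (hz : t < ‖z‖) : dil φ t z = 0 := by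
  rw [dil, hφ.eq_zero, zero_div]
  rw [norm_smul, norm_inv, Real.norm_of_nonneg ht.le, inv_mul_eq_div, one_lt_div ht]
  exact hz

theorem contDiff_dil (hφ : GoodPhi φ) (t : ℝ) : ContDiff ℝ (⊤ : ℕ∞) (dil φ t) :=
  (hφ.smooth.comp (contDiff_const_smul _)).div_const _

theorem hasCompactSupport_dil (hφ : GoodPhi φ) (ht : 0 < t) : HasCompactSupport (dil φ t) :=
  HasCompactSupport.of_support_subset_isCompact (isCompact_closedBall 0 t) fun z hz => by
    by_contra h
    exact hz (dil_eq_zero hφ ht (by simpa using h))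

theorem integrable_dil (hφ : GoodPhi φ) (ht : 0 < t) : Integrable (dil φ t) :=
  (contDiff_dil hφ t).continuous.integrable_of_hasCompactSupport (hasCompactSupport_dil hφ ht)

theorem integral_dil (hφ : GoodPhi φ) (ht : 0 < t) : ∫ z, dil φ t z = 1 := by
  simp only [dil]
  rw [integral_div, Measure.integral_comp_inv_smul, hφ.int_one]
  simp only [finrank_euclideanSpace, Fintype.card_fin, smul_eq_mul, mul_one]
  rw [abs_of_pos (by positivity), div_self (by positivity)]

theorem norm_integral_dil_mul_le (hφ : GoodPhi φ) (ht : 0 < t) {h : RN N → ℂ} {B : ℝ}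
    (hB : ∀ z, ‖z‖ ≤ t → ‖h z‖ ≤ B) : ‖∫ z, (dil φ t z : ℂ) * h z‖ ≤ B := by
  calc _ ≤ ∫ z, dil φ t z * B := by
        refine norm_integral_le_of_norm_le ((integrable_dil hφ ht).mul_const B)
          (Eventually.of_forall fun z => ?_)
        rw [norm_mul, Complex.norm_real, Real.norm_of_nonneg (dil_nonneg hφ ht z)]
        by_cases hz : ‖z‖ ≤ t
        · exact mul_le_mul_of_nonneg_left (hB z hz) (dil_nonneg hφ ht z)
        · simp [dil_eq_zero hφ ht (not_le.1 hz)]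
    _ = B := by rw [integral_mul_const, integral_dil hφ ht, one_mul]

end Dilates

namespace TestFn

open Classical in
/-- The dilate of `φ` as a test function. -/
def kern (φ : RN N → ℝ) (t : ℝ) : TestFn N :=
  if h : (fun z => (dil φ t z : ℂ)) ∈ TestFn N then ⟨_, h⟩ else 0

variable {φ : RN N → ℝ} {t : ℝ}

theorem coe_kern (hφ : GoodPhi φ) (ht : 0 < t) :
    (kern φ t : RN N → ℂ) = fun z => (dil φ t z : ℂ) := by
  rw [kern, dif_pos]
  exact ⟨Complex.ofRealCLM.contDiff.comp (contDiff_dil hφ t),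
    (hasCompactSupport_dil hφ ht).comp_left Complex.ofReal_zero⟩

/-- Convolution with the dilate of `φ`. -/
def avg (φ : RN N → ℝ) (t : ℝ) : Module.End ℂ (TestFn N) := cv (kern φ t)

theorem avg_apply (hφ : GoodPhi φ) (ht : 0 < t) (u : TestFn N) (x : RN N) :
    avg φ t u x = ∫ z, (dil φ t z : ℂ) * u (x - z) := by
  change conv (kern φ t) u x = _
  rw [conv_apply, coe_kern hφ ht]

theorem avg_eq_convAt (hφ : GoodPhi φ) (ht : 0 < t) (u : TestFn N) (x : RN N) :
    avg φ t u x = convAt φ t u x := by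
  change conv (kern φ t) u x = _
  rw [conv_apply', coe_kern hφ ht]
  rfl

theorem avg_comm (s t : ℝ) : Commute (avg φ s) (avg φ t) := cv_comm _ _

theorem D_avg_comm (i : Fin N) (t : ℝ) : Commute (D i) (avg φ t) := D_cv_comm _ _

theorem norm_avg_le (hφ : GoodPhi φ) (ht : 0 < t) (u : TestFn N) {x : RN N} {B : ℝ}
    (hB : ∀ z ∈ closedBall x t, ‖u z‖ ≤ B) : ‖avg φ t u x‖ ≤ B := by
  rw [avg_apply hφ ht]
  exact norm_integral_dil_mul_le hφ ht fun z hz => hB _ (by simpa [dist_eq_norm] using hz)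

theorem sub_avg_apply (hφ : GoodPhi φ) (ht : 0 < t) (u : TestFn N) (x : RN N) :
    (1 - avg φ t) u x = ∫ z, (dil φ t z : ℂ) * (u x - u (x - z)) := by
  have h1 : ∫ z, (dil φ t z : ℂ) * u x = u x := by
    rw [integral_mul_const, integral_complex_ofReal, integral_dil hφ ht]; simp
  have h2 : Integrable fun z => (dil φ t z : ℂ) * u (x - z) := by
    have := integrable_conv (kern φ t) u x
    rwa [coe_kern hφ ht] at this
  change u x - avg φ t u x = _
  rw [avg_apply hφ ht]
  conv_lhs => rw [← h1]
  have h3 : Integrable fun z => (dil φ t z : ℂ) * u x := (integrable_dil hφ ht).ofReal.mul_const _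
  rw [← integral_sub h3 h2]
  simp only [mul_sub]

theorem norm_sub_avg_le_two (hφ : GoodPhi φ) (ht : 0 < t) (u : TestFn N) {x : RN N} {B : ℝ}
    (hB : ∀ z ∈ closedBall x t, ‖u z‖ ≤ B) : ‖(1 - avg φ t) u x‖ ≤ 2 * B := by
  change ‖u x - avg φ t u x‖ ≤ _
  refine (norm_sub_le _ _).trans ?_
  linarith [norm_avg_le hφ ht u hB, hB x (mem_closedBall_self ht.le)]

theorem fderiv_apply_eq_sum (u : TestFn N) (x v : RN N) :
    fderiv ℝ u x v = ∑ i, (v i : ℂ) * D i u x := by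
  have hv : v = ∑ i, v i • EuclideanSpace.single i (1 : ℝ) := by
    ext j
    simp [Pi.single_apply]
  conv_lhs => rw [hv]
  simp [map_sum, map_smul, coe_D, pd]

theorem norm_fderiv_le (u : TestFn N) {x : RN N} {B : ℝ} (hB : ∀ i, ‖D i u x‖ ≤ B) (hB0 : 0 ≤ B) :
    ‖fderiv ℝ u x‖ ≤ N * B := by
  refine ContinuousLinearMap.opNorm_le_bound _ (by positivity) fun v => ?_
  rw [fderiv_apply_eq_sum]
  refine (norm_sum_le_of_le _ (fun i _ => ?_) : _ ≤ ∑ _i : Fin N, ‖v‖ * B).trans ?_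
  · rw [norm_mul, Complex.norm_real]
    exact mul_le_mul (PiLp.norm_apply_le v i) (hB i) (norm_nonneg _) (norm_nonneg _)
  · simp; apply le_of_eq; ring

theorem norm_sub_avg_le (hφ : GoodPhi φ) (ht : 0 < t) (u : TestFn N) {x : RN N} {B : ℝ}
    (hB0 : 0 ≤ B) (hB : ∀ i, ∀ z ∈ closedBall x t, ‖D i u z‖ ≤ B) :
    ‖(1 - avg φ t) u x‖ ≤ N * t * B := by
  rw [sub_avg_apply hφ ht]
  refine norm_integral_dil_mul_le hφ ht fun z hz => ?_
  have := (convex_closedBall x t).norm_image_sub_le_of_norm_fderiv_le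
    (fun y _ => differentiable u y) (fun y hy => norm_fderiv_le u (fun i => hB i y hy) hB0)
    (show x - z ∈ closedBall x t by simpa [dist_eq_norm] using hz) (mem_closedBall_self ht.le)
  refine this.trans ?_
  rw [sub_sub_cancel, mul_right_comm]
  gcongr

theorem one_sub_comm {S T : Module.End ℂ (TestFn N)} (h : Commute S T) : Commute S (1 - T) :=
  Commute.sub_right (R := Module.End ℂ (TestFn N)) (Commute.one_right S) h

theorem mul_add_mul_one_sub (S T : Module.End ℂ (TestFn N)) : S * T + S * (1 - T) = S := by
  have h : ∀ {R : Type _} [Ring R] (a b : R), a * b + a * (1 - b) = a := fun a b => by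
    noncomm_ring
  exact h S T

theorem one_sub_mul_eq {S T : Module.End ℂ (TestFn N)} (hc : Commute S T)
    (U : Module.End ℂ (TestFn N)) : (1 - S) * T = T * (U - S) + T * (1 - U) := by
  have h : ∀ {R : Type _} [Ring R] (a b c : R), a * b = b * a →
      (1 - a) * b = b * (c - a) + b * (1 - c) := fun a b c hab => by
    rw [sub_mul, hab]; noncomm_ring
  exact h S T U hc.eq

/-- The product of the operators `1 - avg (t / 2 ^ i)` over `i < k`. -/
def osc (φ : RN N → ℝ) : ℝ → ℕ → Module.End ℂ (TestFn N)
  | _, 0 => 1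
  | t, k + 1 => (1 - avg φ t) * osc φ (t / 2) k

theorem osc_succ (t : ℝ) (k : ℕ) : osc φ t (k + 1) = (1 - avg φ t) * osc φ (t / 2) k := rfl

theorem osc_succ' (t : ℝ) (k : ℕ) : osc φ t (k + 1) = osc φ t k * (1 - avg φ (t / 2 ^ k)) := by
  induction k generalizing t with
  | zero => simp [osc]
  | succ k ih => rw [osc_succ, ih, ← mul_assoc, ← osc_succ, div_div, pow_succ']

theorem osc_comm_of (T : Module.End ℂ (TestFn N)) (h : ∀ t, Commute T (avg φ t)) (t : ℝ) (k : ℕ) :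
    Commute T (osc φ t k) := by
  induction k generalizing t with
  | zero => exact Commute.one_right T
  | succ k ih => exact Commute.mul_right (one_sub_comm (h t)) (ih _)

theorem D_osc_comm (i : Fin N) (t : ℝ) (k : ℕ) : Commute (D i) (osc φ t k) :=
  osc_comm_of _ (D_avg_comm i) t k

theorem DW_osc_comm (w : List (Fin N)) (t : ℝ) (k : ℕ) : Commute (DW w) (osc φ t k) :=
  DW_comm_of w _ fun i => D_osc_comm i t k

theorem DW_avg_comm (w : List (Fin N)) (t : ℝ) : Commute (DW w) (avg φ t) :=
  DW_comm_of w _ fun i => D_avg_comm i t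

theorem osc_conv (t : ℝ) (k : ℕ) (u v : TestFn N) :
    osc φ t k (conv u v) = conv (osc φ t k u) v := by
  have h : Commute (cv v) (osc φ t k) := osc_comm_of _ (fun s => cv_comm v (kern φ s)) t k
  rw [conv_comm u v, conv_comm _ v]
  exact (LinearMap.congr_fun h.eq u).symm

/-- Finite Calderón-type reproducing formula. -/
theorem reproducing (t : ℝ) (m n : ℕ) :
    (1 : Module.End ℂ (TestFn N)) =
      ∑ k ∈ Finset.range (m + 1), osc φ t k * avg φ (t / 2 ^ k) +
      ∑ j ∈ Finset.range n, osc φ (t / 2 ^ (j + 1)) m *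
        (avg φ (t / 2 ^ (j + m + 1)) - avg φ (t / 2 ^ j)) +
      osc φ (t / 2 ^ n) (m + 1) := by
  induction n with
  | zero =>
    simp only [Finset.range_zero, Finset.sum_empty, add_zero, pow_zero, div_one]
    induction m + 1 with
    | zero => simp [osc]
    | succ k ih =>
      rw [Finset.sum_range_succ, osc_succ', add_assoc, mul_add_mul_one_sub]
      exact ih
  | succ n ih =>
    rw [ih, Finset.sum_range_succ _ n, osc_succ (t / 2 ^ n), osc_succ' (t / 2 ^ (n + 1))]
    have hc : Commute (avg φ (t / 2 ^ n)) (osc φ (t / 2 ^ n / 2) m) :=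
      osc_comm_of _ (fun s => avg_comm _ _) _ _
    have h1 : t / 2 ^ n / 2 = t / 2 ^ (n + 1) := by rw [div_div, pow_succ]
    have h2 : t / 2 ^ (n + 1) / 2 ^ m = t / 2 ^ (n + m + 1) := by
      rw [div_div, ← pow_add]; congr 2; ring
    rw [h1] at hc ⊢
    rw [h2, one_sub_mul_eq hc (avg φ (t / 2 ^ (n + m + 1)))]
    simp only [add_assoc]

theorem norm_osc_le_two_pow (hφ : GoodPhi φ) (ht : 0 < t) (k : ℕ) (u : TestFn N) {x : RN N} {B : ℝ}
    (hB : ∀ z ∈ closedBall x (2 * t), ‖u z‖ ≤ B) : ‖osc φ t k u x‖ ≤ 2 ^ k * B := by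
  induction k generalizing t x with
  | zero => simpa [osc] using hB x (mem_closedBall_self (by positivity))
  | succ k ih =>
    rw [osc_succ, pow_succ', mul_assoc]
    refine norm_sub_avg_le_two hφ ht _ fun z hz => ih (half_pos ht) fun y hy => hB y ?_
    rw [mem_closedBall] at *
    linarith [dist_triangle y z x]

theorem norm_osc_le (hφ : GoodPhi φ) (ht : 0 < t) (k : ℕ) (u : TestFn N) {x : RN N} {B : ℝ}
    (hB0 : 0 ≤ B) (hB : ∀ w : List (Fin N), w.length = k →
      ∀ z ∈ closedBall x (2 * t), ‖DW w u z‖ ≤ B) :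
    ‖osc φ t k u x‖ ≤ (N * t) ^ k * B := by
  induction k generalizing t x u with
  | zero => simpa [osc, DW] using hB [] rfl x (mem_closedBall_self (by positivity))
  | succ k ih =>
    rw [osc_succ, pow_succ', mul_assoc]
    refine norm_sub_avg_le hφ ht _ (by positivity) fun i z hz => ?_
    have hc : D i (osc φ (t / 2) k u) = osc φ (t / 2) k (D i u) :=
      LinearMap.congr_fun (D_osc_comm i (t / 2) k).eq u
    rw [hc]
    refine (ih (half_pos ht) (D i u) fun w hw y hy => ?_).trans ?_
    · rw [← DW_cons_apply]
      refine hB (i :: w) (by simp [hw]) y ?_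
      rw [mem_closedBall] at *
      linarith [dist_triangle y z x]
    · gcongr
      linarith

end TestFn

namespace TestFn

variable {φ : RN N → ℝ}

theorem DW_dilate (w : List (Fin N)) (u v : TestFn N) (c : ℂ) (σ : ℝ)
    (h : ∀ z, u z = c * v (σ • z)) (z : RN N) :
    DW w u z = c * (σ : ℂ) ^ w.length * DW w v (σ • z) := by
  induction w generalizing u v c with
  | nil => simpa [DW] using h z
  | cons i w ih =>
    rw [DW_cons_apply, DW_cons_apply, ih (D i u) (D i v) (c * σ) fun y => ?_]
    · simp only [List.length_cons, pow_succ]; ring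
    · have hu : (u : RN N → ℂ) = fun y => c * v (σ • y) := funext h
      have hd : HasFDerivAt (fun y : RN N => c * v (σ • y))
          (c • (fderiv ℝ v (σ • y)).comp (σ • ContinuousLinearMap.id ℝ (RN N))) y :=
        (HasFDerivAt.comp y (differentiable v (σ • y)).hasFDerivAt
          ((hasFDerivAt_id y).const_smul σ)).const_mul c
      rw [coe_D, coe_D, pd, hu, hd.fderiv]
      simp [pd, mul_assoc]

theorem exists_kern_bound (hφ : GoodPhi φ) (m : ℕ) : ∃ C : ℝ, 0 ≤ C ∧ ∀ σ : ℝ, 0 < σ →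
    ∀ w : List (Fin N), w.length = m → ∀ z, ‖DW w (kern φ σ) z‖ ≤ C / σ ^ (N + m) := by
  obtain ⟨C, hC, h⟩ := exists_DW_bound m (kern φ 1)
  refine ⟨C, hC, fun σ hσ w hw z => ?_⟩
  rw [DW_dilate w (kern φ σ) (kern φ 1) ((σ : ℂ) ^ N)⁻¹ σ⁻¹ fun y => ?_]
  · rw [norm_mul, norm_mul, norm_inv, norm_pow, norm_pow, Complex.norm_real, Complex.norm_real, hw,
      Real.norm_of_nonneg hσ.le, Real.norm_of_nonneg (inv_nonneg.2 hσ.le), inv_pow, ← mul_inv,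
      ← pow_add, inv_mul_eq_div]
    gcongr
    exact h w hw _
  · rw [coe_kern hφ hσ, coe_kern hφ one_pos]
    simp [dil, div_eq_inv_mul]

theorem kern_eq_zero (hφ : GoodPhi φ) {σ : ℝ} (hσ : 0 < σ) {z : RN N} (hz : σ < ‖z‖) :
    kern φ σ z = 0 := by
  rw [coe_kern hφ hσ]; simp [dil_eq_zero hφ hσ hz]

theorem osc_kern_eq_zero (hφ : GoodPhi φ) {σ τ : ℝ} (hσ : 0 < σ) (hτ : 0 < τ) (hτσ : 2 * τ ≤ σ)
    (k : ℕ) {z : RN N} (hz : 2 * σ < ‖z‖) : osc φ τ k (kern φ σ) z = 0 := by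
  have := norm_osc_le_two_pow hφ hτ k (kern φ σ) (x := z) (B := 0) fun y hy => ?_
  · simpa using this
  · rw [kern_eq_zero hφ hσ, norm_zero]
    rw [mem_closedBall, dist_comm, dist_eq_norm] at hy
    linarith [norm_sub_norm_le z y]

theorem norm_conv_le (K v : TestFn N) {B r : ℝ} (hB : ∀ z, ‖K z‖ ≤ B)
    (hr : ∀ z, r < ‖z‖ → K z = 0) (x : RN N) :
    ‖conv K v x‖ ≤ B * ∫ y in closedBall x r, ‖v y‖ := by
  rw [conv_apply', ← integral_const_mul, ← integral_indicator measurableSet_closedBall]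
  refine norm_integral_le_of_norm_le ?_ (Eventually.of_forall fun y => ?_)
  · exact ((integrable v).norm.const_mul B).indicator measurableSet_closedBall
  · by_cases hy : y ∈ closedBall x r
    · rw [indicator_of_mem hy, norm_mul]
      exact mul_le_mul_of_nonneg_right (hB _) (norm_nonneg _)
    · rw [indicator_of_notMem hy, hr, zero_mul, norm_zero]
      rw [mem_closedBall, dist_comm, dist_eq_norm] at hy
      exact not_le.1 hy

theorem tendsto_osc (hφ : GoodPhi φ) {t : ℝ} (ht : 0 < t) {k : ℕ} (hk : k ≠ 0) (u : TestFn N)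
    (x : RN N) : Tendsto (fun n : ℕ => ‖osc φ (t / 2 ^ n) k u x‖) atTop (𝓝 0) := by
  obtain ⟨B, hB, h⟩ := exists_DW_bound k u
  refine squeeze_zero (fun n => norm_nonneg _)
    (fun n => norm_osc_le hφ (by positivity) k u hB fun w hw z _ => h w hw z) ?_
  have h1 : Tendsto (fun n : ℕ => t / 2 ^ n) atTop (𝓝 0) :=
    tendsto_const_nhds.div_atTop (tendsto_pow_atTop_atTop_of_one_lt one_lt_two)
  have h2 := ((h1.const_mul (N : ℝ)).pow k).mul_const B
  simpa [hk] using h2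

theorem reproducing_apply (t : ℝ) (m n : ℕ) (u : TestFn N) (x : RN N) :
    u x = ∑ k ∈ Finset.range (m + 1), osc φ t k (avg φ (t / 2 ^ k) u) x +
      ∑ j ∈ Finset.range n, osc φ (t / 2 ^ (j + 1)) m
        (avg φ (t / 2 ^ (j + m + 1)) u - avg φ (t / 2 ^ j) u) x +
      osc φ (t / 2 ^ n) (m + 1) u x := by
  have := congrArg (fun T : Module.End ℂ (TestFn N) => (T u : RN N → ℂ) x)
    (reproducing (φ := φ) t m n)
  simpa [LinearMap.sum_apply, AddSubmonoidClass.coe_finsetSum] using this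

theorem exists_avg_le_sum (hφ : GoodPhi φ) (m : ℕ) : ∃ C : ℝ, 0 < C ∧ ∀ (u : TestFn N) (σ : ℝ),
    0 < σ → ∀ (z : RN N) (J : ℕ → ℝ),
    (∀ j, ∫ y in closedBall z (2 * σ), ‖avg φ (σ / 2 / 2 ^ j) u y‖ ≤ J j) → ∀ n : ℕ,
    ‖avg φ σ u z‖ ≤ C / σ ^ N * (∑ k ∈ Finset.range (m + 1), J k +
      ∑ j ∈ Finset.range n, ((2 : ℝ) ^ m)⁻¹ ^ j * (J (j + m + 1) + J j)) +
      ‖osc φ (σ / 2 / 2 ^ n) (m + 1) (avg φ σ u) z‖ := by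
  obtain ⟨C₀, hC₀, h₀⟩ := exists_kern_bound hφ 0
  obtain ⟨C₁, hC₁, h₁⟩ := exists_kern_bound hφ m
  set C := 2 ^ m * C₀ + N ^ m * C₁ + 1
  have hCpos : 0 < C := by positivity
  refine ⟨C, hCpos, fun u σ hσ z J hJ n => ?_⟩
  have hJ0 : ∀ j, 0 ≤ J j := fun j => (integral_nonneg fun y => norm_nonneg _).trans (hJ j)
  have hswap : ∀ τ, avg φ τ (avg φ σ u) = conv (kern φ σ) (avg φ τ u) := fun τ =>
    LinearMap.congr_fun (avg_comm τ σ).eq u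
  have hgen : ∀ (τ : ℝ) (k : ℕ) (v : TestFn N) (b I : ℝ), 0 < τ → 2 * τ ≤ σ →
      (∀ y, ‖osc φ τ k (kern φ σ) y‖ ≤ b) → 0 ≤ b → ∫ y in closedBall z (2 * σ), ‖v y‖ ≤ I →
      ‖osc φ τ k (conv (kern φ σ) v) z‖ ≤ b * I := fun τ k v b I hτ hτσ hb hb0 hI => by
    rw [osc_conv]
    refine (norm_conv_le _ v hb (fun y hy => osc_kern_eq_zero hφ hσ hτ hτσ k hy) z).trans ?_
    exact mul_le_mul_of_nonneg_left hI hb0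
  rw [reproducing_apply (φ := φ) (σ / 2) m n (avg φ σ u) z, mul_add, Finset.mul_sum,
    Finset.mul_sum]
  refine (norm_add₃_le).trans ?_
  refine add_le_add (add_le_add ?_ ?_) le_rfl
  · refine norm_sum_le_of_le _ fun k hk => ?_
    rw [hswap]
    refine hgen _ _ _ _ _ (by positivity) (by linarith) (fun y => ?_) (by positivity) (hJ k)
    refine (norm_osc_le_two_pow hφ (by positivity) k _ (B := C₀ / σ ^ N)
      fun y _ => by simpa [DW] using h₀ σ hσ [] rfl y).trans ?_
    rw [← mul_div_assoc]
    gcongr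
    have : (2 : ℝ) ^ k ≤ 2 ^ m :=
      pow_le_pow_right₀ one_le_two (Nat.lt_succ_iff.1 (Finset.mem_range.1 hk))
    have : (2 : ℝ) ^ k * C₀ ≤ 2 ^ m * C₀ := by gcongr
    have : 0 ≤ (N : ℝ) ^ m * C₁ := by positivity
    simp only [C]; linarith
  · refine norm_sum_le_of_le _ fun j _ => ?_
    rw [hswap, hswap, ← cv_apply, ← cv_apply, ← map_sub, cv_apply, ← mul_assoc]
    have h2j : (1 : ℝ) ≤ 2 ^ (j + 1) := one_le_pow₀ one_le_two
    refine hgen _ _ _ _ _ (by positivity) ?_ (fun y => ?_) (by positivity) ?_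
    · have : σ / 2 / 2 ^ (j + 1) ≤ σ / 2 := div_le_self (by positivity) h2j
      linarith
    · refine (norm_osc_le hφ (by positivity) m _ (B := C₁ / σ ^ (N + m)) (by positivity)
        fun w hw y _ => h₁ σ hσ w hw y).trans ?_
      have e : (N * (σ / 2 / 2 ^ (j + 1))) ^ m * (C₁ / σ ^ (N + m)) =
          (N ^ m * C₁ * (1 / 4) ^ m) / σ ^ N * (2 ^ m)⁻¹ ^ j := by
        rw [pow_succ, inv_pow, ← pow_mul, mul_comm m j, pow_mul, pow_add]
        simp only [mul_pow, div_pow]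
        field_simp
        rw [show (4 : ℝ) ^ m = (2 ^ m) ^ 2 by rw [← pow_mul, mul_comm, pow_mul]; norm_num]
        ring
      rw [e]
      gcongr
      have h4 : (1 / 4 : ℝ) ^ m ≤ 1 := pow_le_one₀ (by norm_num) (by norm_num)
      have : N ^ m * C₁ * (1 / 4 : ℝ) ^ m ≤ N ^ m * C₁ := mul_le_of_le_one_right (by positivity) h4
      have : 0 ≤ (2 : ℝ) ^ m * C₀ := by positivity
      simp only [C]; linarith
    · have hi : ∀ v : TestFn N, IntegrableOn (fun y => ‖v y‖) (closedBall z (2 * σ)) :=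
        fun v => (integrable v).norm.integrableOn
      calc _ ≤ ∫ y in closedBall z (2 * σ), (‖avg φ (σ / 2 / 2 ^ (j + m + 1)) u y‖ +
              ‖avg φ (σ / 2 / 2 ^ j) u y‖) :=
            integral_mono (hi _) ((hi _).add (hi _)) fun y => norm_sub_le _ _
        _ ≤ _ := by
            rw [integral_add (hi _) (hi _)]
            exact add_le_add (hJ _) (hJ _)

theorem sum_inv_pow_mul_le (m n : ℕ) {b : ℝ} (hb : 1 ≤ b) (hbm : b < 2 ^ m) :
    ∑ k ∈ Finset.range (m + 1), b ^ (k + 1) +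
      ∑ j ∈ Finset.range n, ((2 : ℝ) ^ m)⁻¹ ^ j * (b ^ (j + m + 1 + 1) + b ^ (j + 1)) ≤
    (m + 1) * b ^ (m + 1) + 2 * b ^ (m + 2) * (1 - b / 2 ^ m)⁻¹ := by
  have h2 : (0 : ℝ) < 2 ^ m := by positivity
  have hlt : b / 2 ^ m < 1 := (div_lt_one h2).2 hbm
  gcongr ?_ + ?_
  · refine (Finset.sum_le_card_nsmul _ _ (b ^ (m + 1)) fun k hk => ?_).trans (by simp)
    exact pow_le_pow_right₀ hb (by have := Finset.mem_range.1 hk; omega)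
  · calc _ ≤ ∑ j ∈ Finset.range n, 2 * b ^ (m + 2) * (b / 2 ^ m) ^ j := by
          refine Finset.sum_le_sum fun j _ => ?_
          have h1 : b ^ (j + 1) ≤ b ^ (j + m + 1 + 1) := pow_le_pow_right₀ hb (by omega)
          have e : 2 * b ^ (m + 2) * (b / 2 ^ m) ^ j =
              ((2 : ℝ) ^ m)⁻¹ ^ j * (2 * b ^ (j + m + 1 + 1)) := by
            rw [div_pow, inv_pow, div_eq_mul_inv]; ring
          rw [e]
          gcongr
          linarith
      _ ≤ _ := by
          rw [← Finset.mul_sum]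
          gcongr
          rw [← tsum_geometric_of_lt_one (by positivity) hlt]
          exact (summable_geometric_of_lt_one (by positivity) hlt).sum_le_tsum _
            fun _ _ => by positivity

end TestFn

namespace TestFn

variable {φ : RN N → ℝ}

theorem setIntegral_norm_le_of_bound {q : ℝ} (hq0 : 0 < q) (hq1 : q ≤ 1) (v : TestFn N)
    (G : RN N → ℝ≥0∞) {s S : Set (RN N)} (hs : MeasurableSet s) (hsS : s ⊆ S)
    (hG : ∀ y, ‖v y‖ₑ ≤ G y) {L : ℝ} (hL0 : 0 ≤ L) (hL : ∀ y ∈ s, ‖v y‖ ≤ L)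
    (hI : ∫⁻ y in S, G y ^ q ≠ ∞) :
    ∫ y in s, ‖v y‖ ≤ L ^ (1 - q) * (∫⁻ y in S, G y ^ q).toReal := by
  have hq : 0 ≤ 1 - q := by linarith
  rw [integral_norm_eq_lintegral_enorm (continuous v).aestronglyMeasurable,
    ← ENNReal.toReal_ofReal (Real.rpow_nonneg hL0 (1 - q)), ← ENNReal.toReal_mul]
  refine ENNReal.toReal_mono (ENNReal.mul_ne_top ENNReal.ofReal_ne_top hI) ?_
  rw [← lintegral_const_mul' _ _ ENNReal.ofReal_ne_top]
  refine (setLIntegral_mono' hs fun y hy => ?_).trans (lintegral_mono_set hsS)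
  have h1 : ‖v y‖ₑ ≤ ENNReal.ofReal L := by
    rw [← ofReal_norm]; exact ENNReal.ofReal_le_ofReal (hL y hy)
  calc ‖v y‖ₑ = ‖v y‖ₑ ^ (1 - q) * ‖v y‖ₑ ^ q := by
        rw [← ENNReal.rpow_add_of_nonneg _ _ hq hq0.le]; simp
    _ ≤ ENNReal.ofReal L ^ (1 - q) * G y ^ q := by
        gcongr
        exact hG y
    _ = _ := by rw [ENNReal.ofReal_rpow_of_nonneg hL0 hq]

/-- Sub-mean value property: the averages of `u` are controlled by the `L^q` means of any
majorant `G` of all the averages of `u`. -/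
theorem exists_avg_rpow_le (hφ : GoodPhi φ) {q : ℝ} (hq0 : 0 < q) (hq1 : q ≤ 1) {m : ℕ}
    (hqm : N / q - N < m) : ∃ C : ℝ, 0 < C ∧ ∀ (u : TestFn N) (G : RN N → ℝ≥0∞),
    (∀ z, ∀ s ∈ Ioo (0 : ℝ) 1, ‖avg φ s u z‖ₑ ≤ G z) → ∀ x, ∀ s ∈ Ioo (0 : ℝ) 1,
    ‖avg φ s u x‖ₑ ^ q ≤
      ENNReal.ofReal (C / s ^ N) * ∫⁻ y in closedBall x (4 * s), G y ^ q := by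
  obtain ⟨C₀, hC₀, hrep⟩ := exists_avg_le_sum hφ m
  set κ : ℝ := N / q - N with hκ
  have hκ0 : 0 ≤ κ := sub_nonneg.2 (le_div_self (Nat.cast_nonneg N) hq0 hq1)
  set b : ℝ := 2 ^ κ with hb
  have hb1 : 1 ≤ b := Real.one_le_rpow one_le_two hκ0
  have hbm : b < 2 ^ m := by
    rw [hb, ← Real.rpow_natCast]
    exact Real.rpow_lt_rpow_of_exponent_lt one_lt_two hqm
  set C₁ : ℝ := (m + 1) * b ^ (m + 1) + 2 * b ^ (m + 2) * (1 - b / 2 ^ m)⁻¹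
  have hC₁ : 0 < C₁ := by
    have : 0 ≤ (1 - b / 2 ^ m)⁻¹ :=
      inv_nonneg.2 (sub_nonneg.2 ((div_le_one (by positivity)).2 hbm.le))
    positivity
  refine ⟨C₀ * C₁, by positivity, fun u G hG x s hs => ?_⟩
  have hs0 := hs.1
  have hCs : 0 < C₀ * C₁ / s ^ N := by positivity
  by_cases hI : ∫⁻ y in closedBall x (4 * s), G y ^ q = ∞
  · rw [hI, ENNReal.mul_top (by simpa using hCs)]; exact le_top
  set I := (∫⁻ y in closedBall x (4 * s), G y ^ q).toReal with hIdef
  have hI0 : 0 ≤ I := ENNReal.toReal_nonneg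
  set M : ℝ := N / q with hM
  have hM0 : 0 ≤ M := by positivity
  obtain ⟨Bu, hBu, hu⟩ := exists_bound u
  set S : Set ℝ := {r | ∃ σ : ℝ, ∃ z : RN N, σ ∈ Ioo (0 : ℝ) 1 ∧ 4 * σ + dist z x ≤ 4 * s ∧
    r = σ ^ M * ‖avg φ σ u z‖}
  have hSbdd : BddAbove S := by
    refine ⟨Bu, ?_⟩
    rintro r ⟨σ, z, hσ, -, rfl⟩
    have h1 : σ ^ M ≤ 1 := Real.rpow_le_one hσ.1.le hσ.2.le hM0
    have h2 : ‖avg φ σ u z‖ ≤ Bu := norm_avg_le hφ hσ.1 u fun y _ => hu y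
    calc _ ≤ 1 * Bu := by gcongr
      _ = Bu := one_mul _
  have hxS : s ^ M * ‖avg φ s u x‖ ∈ S := ⟨s, x, hs, by simp, rfl⟩
  set F := sSup S with hF
  have hF0 : 0 ≤ F := (mul_nonneg (Real.rpow_nonneg hs0.le _) (norm_nonneg _)).trans
    (le_csSup hSbdd hxS)
  have hstep : ∀ r ∈ S, r ≤ C₀ * C₁ * (F ^ (1 - q) * I) := by
    rintro r ⟨σ, z, hσ, hz, rfl⟩
    have hσ0 := hσ.1
    set E : ℝ := F ^ (1 - q) * I * σ ^ (-κ) with hE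
    have hE0 : 0 ≤ E := by positivity
    have hJ : ∀ j : ℕ, ∫ y in closedBall z (2 * σ), ‖avg φ (σ / 2 / 2 ^ j) u y‖ ≤
        E * b ^ (j + 1) := by
      intro j
      have h2j : (1 : ℝ) ≤ 2 ^ j := one_le_pow₀ one_le_two
      set τ := σ / 2 / 2 ^ j with hτ
      have hτ0 : 0 < τ := by positivity
      have hτσ : τ ≤ σ / 2 := div_le_self (by positivity) h2j
      have hτ1 : τ < 1 := by linarith [hσ.2]
      have hb1 := setIntegral_norm_le_of_bound hq0 hq1 (avg φ τ u) G
        (s := closedBall z (2 * σ)) (S := closedBall x (4 * s)) (L := F * τ ^ (-M))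
        measurableSet_closedBall
        (closedBall_subset_closedBall' (by linarith)) (fun y => hG y τ ⟨hτ0, hτ1⟩)
        (by positivity) (fun y hy => ?_) hI
      · refine hb1.trans (le_of_eq ?_)
        have e1 : (F * τ ^ (-M)) ^ (1 - q) = F ^ (1 - q) * τ ^ (-κ) := by
          rw [Real.mul_rpow hF0 (by positivity), ← Real.rpow_mul hτ0.le]
          have hMq : M * q = N := div_mul_cancel₀ _ hq0.ne'
          have : -M * (1 - q) = -κ := by rw [hκ]; linarith
          rw [this]
        have e2 : τ ^ (-κ) = σ ^ (-κ) * b ^ (j + 1) := by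
          have h1 : τ = σ * ((2 : ℝ) ^ (j + 1))⁻¹ := by rw [hτ, pow_succ]; field_simp
          have h2 : ((2 : ℝ) ^ (j + 1))⁻¹ ^ (-κ) = b ^ (j + 1) := by
            rw [Real.inv_rpow (by positivity), Real.rpow_neg (by positivity), inv_inv, hb,
              ← Real.rpow_natCast, ← Real.rpow_natCast, ← Real.rpow_mul two_pos.le,
              ← Real.rpow_mul two_pos.le, mul_comm κ]
          rw [h1, Real.mul_rpow hσ0.le (by positivity), h2]
        rw [e1, e2, hE]; ring
      · have hmem : τ ^ M * ‖avg φ τ u y‖ ∈ S := by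
          refine ⟨τ, y, ⟨hτ0, hτ1⟩, ?_, rfl⟩
          rw [mem_closedBall] at hy
          linarith [dist_triangle y z x]
        rw [Real.rpow_neg hτ0.le, ← div_eq_mul_inv, le_div_iff₀ (by positivity), mul_comm]
        exact le_csSup hSbdd hmem
    have hlim := (tendsto_osc hφ (t := σ / 2) (by positivity) (Nat.succ_ne_zero m) (avg φ σ u)
      z).const_add (C₀ / σ ^ N * (E * C₁))
    rw [add_zero] at hlim
    have hmain : ‖avg φ σ u z‖ ≤ C₀ / σ ^ N * (E * C₁) := by
      refine ge_of_tendsto' hlim fun n => (hrep u σ hσ0 z _ hJ n).trans ?_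
      refine add_le_add ?_ le_rfl
      gcongr
      have := sum_inv_pow_mul_le m n hb1 hbm
      refine le_trans (le_of_eq ?_) (mul_le_mul_of_nonneg_left this hE0)
      rw [mul_add, Finset.mul_sum, Finset.mul_sum]
      congr 1
      exact Finset.sum_congr rfl fun j _ => by ring
    have e3 : σ ^ M * σ ^ (-κ) = σ ^ N := by
      rw [← Real.rpow_add hσ0, ← Real.rpow_natCast]
      congr 1
      rw [hM, hκ]; ring
    calc σ ^ M * ‖avg φ σ u z‖ ≤ σ ^ M * (C₀ / σ ^ N * (E * C₁)) := by gcongr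
      _ = (σ ^ M * σ ^ (-κ)) / σ ^ N * (C₀ * C₁ * (F ^ (1 - q) * I)) := by rw [hE]; ring
      _ = _ := by rw [e3, div_self (by positivity), one_mul]
  have hFle : F ≤ C₀ * C₁ * (F ^ (1 - q) * I) := csSup_le ⟨_, hxS⟩ hstep
  have hFq : F ^ q ≤ C₀ * C₁ * I := by
    rcases hF0.eq_or_lt with h | h
    · rw [← h, Real.zero_rpow hq0.ne']; positivity
    · have : F ^ q * F ^ (1 - q) = F := by rw [← Real.rpow_add h]; simp
      refine le_of_mul_le_mul_right ?_ (Real.rpow_pos_of_pos h (1 - q))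
      rw [this]
      linarith
  have hreal : ‖avg φ s u x‖ ^ q ≤ C₀ * C₁ / s ^ N * I := by
    have h1 : (s ^ M * ‖avg φ s u x‖) ^ q ≤ F ^ q :=
      Real.rpow_le_rpow (by positivity) (le_csSup hSbdd hxS) hq0.le
    have h2 : (s ^ M * ‖avg φ s u x‖) ^ q = s ^ N * ‖avg φ s u x‖ ^ q := by
      rw [Real.mul_rpow (by positivity) (norm_nonneg _), ← Real.rpow_mul hs0.le, hM,
        div_mul_cancel₀ _ hq0.ne', Real.rpow_natCast]
    rw [div_mul_eq_mul_div, le_div_iff₀ (by positivity)]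
    linarith
  rw [← ENNReal.ofReal_toReal hI, ← ENNReal.ofReal_mul hCs.le, ← ofReal_norm,
    ENNReal.ofReal_rpow_of_nonneg (norm_nonneg _) hq0.le]
  exact ENNReal.ofReal_le_ofReal hreal

end TestFn

namespace TestFn

theorem list_map_prod_eq {M : Type*} [CommMonoid M] (g : Fin N → M) (w : List (Fin N)) :
    (w.map g).prod = (List.ofFn fun i => g i ^ w.count i).prod := by
  rw [List.prod_ofFn, Finset.prod_list_map_count]
  refine Finset.prod_subset (Finset.subset_univ _) fun i _ hi => ?_
  rw [List.count_eq_zero_of_not_mem (by simpa using hi), pow_zero]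

theorem md_eq (β : Fin N → ℕ) (u : TestFn N) :
    md β (u : RN N → ℂ) = ((List.ofFn fun i => D i ^ β i).prod u : TestFn N) := by
  have key : ∀ L : List (Fin N), ∀ u : TestFn N,
      ((L.map fun i => (pd i)^[β i]).foldr (· ∘ ·) id) (u : RN N → ℂ) =
        ((L.map fun i => D i ^ β i).prod u : TestFn N) := by
    intro L u
    induction L with
    | nil => simp
    | cons i L ih =>
      simp only [List.map_cons, List.foldr_cons, Function.comp_apply, ih, List.prod_cons]
      rw [Module.End.mul_apply]
      generalize (L.map fun i => D i ^ β i).prod u = v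
      induction β i with
      | zero => simp
      | succ k ih => rw [Function.iterate_succ_apply', ih, pow_succ']; rfl
  rw [md, List.ofFn_eq_map, List.ofFn_eq_map, key]

open scoped IsMulCommutative in
theorem exists_DW_eq_md (w : List (Fin N)) :
    ∃ β ∈ idxLe N w.length, ∀ u : TestFn N, (DW w u : RN N → ℂ) = md β u := by
  refine ⟨fun i => w.count i, ?_, fun u => ?_⟩
  · have hsum : mOrder (fun i => w.count i) = w.length := by
      rw [mOrder, ← Multiset.coe_card, ← Multiset.sum_count_eq_card (s := Finset.univ) (by simp)]
      simp
    simp only [idxLe, Finset.mem_filter, Fintype.mem_piFinset, Finset.mem_range]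
    exact ⟨fun i => Nat.lt_succ_of_le List.count_le_length, hsum.le⟩
  · have hc : ∀ a ∈ range (D (N := N)), ∀ b ∈ range (D (N := N)), a * b = b * a := by
      rintro _ ⟨i, rfl⟩ _ ⟨j, rfl⟩
      exact D_comm i j
    have := Submonoid.isMulCommutative_closure (Module.End ℂ (TestFn N)) hc
    let D' : Fin N → Submonoid.closure (range (D (N := N))) := fun i =>
      ⟨D i, Submonoid.subset_closure ⟨i, rfl⟩⟩
    have h : (w.map D').prod = (List.ofFn fun i => D' i ^ w.count i).prod :=
      list_map_prod_eq D' w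
    have h2 := congrArg (Submonoid.subtype _) h
    rw [map_list_prod, map_list_prod, List.map_map, List.map_ofFn] at h2
    rw [md_eq]
    change ((DW w u : TestFn N) : RN N → ℂ) = _
    have h3 : DW w = (List.ofFn fun i => D i ^ w.count i).prod := h2
    rw [h3]

/-- The operator of differentiation in the direction `v`. -/
def dirD (v : RN N) : Module.End ℂ (TestFn N) := ∑ i, (v i : ℂ) • D i

theorem dirD_apply (v : RN N) (u : TestFn N) : dirD v u = ∑ i, (v i : ℂ) • D i u := by
  rw [dirD, LinearMap.sum_apply]
  rfl

theorem dirD_apply_apply (v : RN N) (u : TestFn N) (x : RN N) :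
    dirD v u x = fderiv ℝ u x v := by
  rw [fderiv_apply_eq_sum, dirD_apply]
  simp [Finset.sum_apply]

theorem dirD_pow_succ_apply (v : RN N) (k : ℕ) (u : TestFn N) (x : RN N) :
    (dirD v ^ (k + 1)) u x = ∑ i, (v i : ℂ) * (dirD v ^ k) (D i u) x := by
  have : (dirD v ^ (k + 1)) u = (dirD v ^ k) (dirD v u) := by rw [pow_succ]; rfl
  rw [this, dirD_apply, map_sum]
  simp [Finset.sum_apply]

theorem norm_dirD_pow_le (v : RN N) (k : ℕ) (u : TestFn N) {x : RN N} {B : ℝ}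
    (hB : ∀ w : List (Fin N), w.length = k → ‖DW w u x‖ ≤ B) :
    ‖(dirD v ^ k) u x‖ ≤ (N * ‖v‖) ^ k * B := by
  induction k generalizing u with
  | zero => simpa [DW] using hB [] rfl
  | succ k ih =>
    rw [dirD_pow_succ_apply]
    have hi : ∀ i, ‖(dirD v ^ k) (D i u) x‖ ≤ (N * ‖v‖) ^ k * B := fun i =>
      ih (D i u) fun w hw => by
        rw [← DW_cons_apply]
        exact hB (i :: w) (by simp [hw])
    refine (norm_sum_le_of_le _ (fun i _ => ?_) :
      _ ≤ ∑ _i : Fin N, ‖v‖ * ((N * ‖v‖) ^ k * B)).trans ?_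
    · rw [norm_mul, Complex.norm_real]
      exact mul_le_mul (PiLp.norm_apply_le v i) (hi i) (norm_nonneg _) (norm_nonneg _)
    · rw [Finset.sum_const, Finset.card_univ, Fintype.card_fin, nsmul_eq_mul]
      exact le_of_eq (by ring)

/-- The Taylor polynomial of order `k` at `x`, as a function of the increment `v`. -/
def taylor (k : ℕ) (u : TestFn N) (x v : RN N) : ℂ :=
  ∑ j ∈ Finset.range k, ((j.factorial : ℝ)⁻¹ : ℂ) * (dirD v ^ j) u x

theorem norm_sub_taylor_le_aux (k : ℕ) (u : TestFn N) (x v : RN N) {B : ℝ}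
    (hB : ∀ θ ∈ Icc (0 : ℝ) 1, ‖(dirD v ^ k) u (x + θ • v)‖ ≤ B) :
    ∀ θ ∈ Icc (0 : ℝ) 1, ‖u (x + θ • v) -
      ∑ j ∈ Finset.range k, ((θ ^ j / j.factorial : ℝ) : ℂ) * (dirD v ^ j) u x‖ ≤ B := by
  induction k generalizing u with
  | zero => simpa using hB
  | succ k ih =>
    intro θ hθ
    have hstep := ih (dirD v u) (by
      intro s hs
      have := hB s hs
      rwa [pow_succ] at this)
    set h : ℝ → ℂ := fun s => u (x + s • v) -
      ∑ j ∈ Finset.range (k + 1), ((s ^ j / j.factorial : ℝ) : ℂ) * (dirD v ^ j) u x with hh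
    have hd : ∀ s, HasDerivAt h (dirD v u (x + s • v) -
        ∑ j ∈ Finset.range k, ((s ^ j / j.factorial : ℝ) : ℂ) * (dirD v ^ j) (dirD v u) x) s := by
      intro s
      refine HasDerivAt.sub ?_ ?_
      · rw [dirD_apply_apply]
        have h1 : HasDerivAt (fun s : ℝ => x + s • v) v s := by
          simpa using ((hasDerivAt_id s).smul_const v).const_add x
        exact ((differentiable u) (x + s • v)).hasFDerivAt.comp_hasDerivAt s h1
      · have h2 : ∀ j : ℕ, HasDerivAt (fun s : ℝ => ((s ^ (j + 1) / (j + 1).factorial : ℝ) : ℂ))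
            ((s ^ j / j.factorial : ℝ) : ℂ) s := by
          intro j
          have h3 := (hasDerivAt_pow (j + 1) s).div_const ((j + 1).factorial : ℝ)
          have h4 : ((j + 1 : ℕ) : ℝ) * s ^ (j + 1 - 1) / ((j + 1).factorial : ℝ) =
              s ^ j / j.factorial := by
            rw [Nat.factorial_succ]
            have : (j.factorial : ℝ) ≠ 0 := by positivity
            push_cast
            field_simp
          rw [h4] at h3
          exact h3.ofReal_comp
        simp only [Finset.sum_range_succ' _ k]
        have h5 := (HasDerivAt.fun_sum (u := Finset.range k) fun j _ =>
          (h2 j).mul_const ((dirD v ^ (j + 1)) u x)).add_const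
            (((s ^ 0 / (Nat.factorial 0) : ℝ) : ℂ) * (dirD v ^ 0) u x)
        simp only [pow_zero] at h5 ⊢
        convert h5 using 3
        rw [pow_succ]
        rfl
    have hmv := (convex_Icc (0 : ℝ) 1).norm_image_sub_le_of_norm_hasDerivWithin_le
      (fun s _ => (hd s).hasDerivWithinAt) hstep (left_mem_Icc.2 zero_le_one) hθ
    have h0 : h 0 = 0 := by
      rw [hh]
      simp [Finset.sum_range_succ']
    rw [h0, sub_zero, sub_zero, Real.norm_of_nonneg hθ.1] at hmv
    have hB0 : 0 ≤ B := (norm_nonneg _).trans (hB 0 (left_mem_Icc.2 zero_le_one))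
    exact hmv.trans (mul_le_of_le_one_right hB0 hθ.2)

theorem norm_sub_taylor_le (k : ℕ) (u : TestFn N) (x y : RN N) {r B : ℝ} (hy : y ∈ closedBall x r)
    (hB : ∀ w : List (Fin N), w.length = k → ∀ z ∈ closedBall x r, ‖DW w u z‖ ≤ B) :
    ‖u y - taylor k u x (y - x)‖ ≤ (N * ‖y - x‖) ^ k * B := by
  have := norm_sub_taylor_le_aux k u x (y - x) (B := (N * ‖y - x‖) ^ k * B) (fun θ hθ =>
    norm_dirD_pow_le _ k u fun w hw => hB w hw _ ?_) 1 (right_mem_Icc.2 zero_le_one)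
  · simpa [taylor] using this
  · rw [mem_closedBall, dist_eq_norm] at hy ⊢
    rw [add_sub_cancel_left, norm_smul, Real.norm_of_nonneg hθ.1]
    exact (mul_le_of_le_one_left (norm_nonneg _) hθ.2).trans hy

theorem isPolyDegLE_eval (d : ℕ) (Q : MvPolynomial (Fin N) ℂ) (hQ : Q.totalDegree ≤ d) :
    IsPolyDegLE N d fun x => MvPolynomial.eval (fun i => ((x i : ℝ) : ℂ)) Q := by
  refine ⟨fun β => Q.coeff (Finsupp.equivFunOnFinite.symm β), fun x => ?_⟩
  change MvPolynomial.eval (fun i => ((x i : ℝ) : ℂ)) Q = _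
  rw [MvPolynomial.eval_eq']
  refine Eq.trans ?_ (Finset.sum_map (idxLe N d) Finsupp.equivFunOnFinite.symm.toEmbedding
    (fun s => Q.coeff s * ∏ i, ((x i : ℝ) : ℂ) ^ s i))
  refine Finset.sum_subset (fun s hs => ?_) fun s _ hs => ?_
  · simp only [Finset.mem_map_equiv, Equiv.symm_symm, idxLe, Finset.mem_filter,
      Fintype.mem_piFinset, Finset.mem_range]
    have h1 : ∑ i, s i ≤ d := by
      refine le_trans ?_ hQ
      have := MvPolynomial.le_totalDegree hs
      rwa [Finsupp.sum_fintype _ _ (fun _ => rfl)] at this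
    exact ⟨fun i => Nat.lt_succ_of_le
      ((Finset.single_le_sum (fun _ _ => Nat.zero_le _) (Finset.mem_univ i)).trans h1), h1⟩
  · rw [MvPolynomial.notMem_support_iff.1 hs, zero_mul]

theorem exists_taylor_eq_eval (k : ℕ) (u : TestFn N) (x : RN N) :
    ∃ Q : MvPolynomial (Fin N) ℂ, Q.totalDegree ≤ k - 1 ∧
      ∀ y, taylor k u x (y - x) = MvPolynomial.eval (fun i => ((y i : ℝ) : ℂ)) Q := by
  have key : ∀ (j : ℕ) (u : TestFn N), ∃ Q : MvPolynomial (Fin N) ℂ, Q.totalDegree ≤ j ∧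
      ∀ y, (dirD (y - x) ^ j) u x = MvPolynomial.eval (fun i => ((y i : ℝ) : ℂ)) Q := by
    intro j
    induction j with
    | zero => exact fun u => ⟨MvPolynomial.C (u x), by simp, fun y => by simp⟩
    | succ j ih =>
      intro u
      choose Q hQ h using fun i => ih (D i u)
      refine ⟨∑ i, (MvPolynomial.X i - MvPolynomial.C (x i : ℂ)) * Q i, ?_, fun y => ?_⟩
      · refine MvPolynomial.totalDegree_finsetSum_le fun i _ => ?_
        refine (MvPolynomial.totalDegree_mul _ _).trans ?_
        have h1 := MvPolynomial.totalDegree_sub_C_le (MvPolynomial.X i : MvPolynomial (Fin N) ℂ)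
          (x i : ℂ)
        rw [MvPolynomial.totalDegree_X] at h1
        have := hQ i
        omega
      · rw [dirD_pow_succ_apply, map_sum]
        exact Finset.sum_congr rfl fun i _ => by simp [h i y]
  choose Q hQ h using fun j => key j u
  refine ⟨∑ j ∈ Finset.range k, MvPolynomial.C ((j.factorial : ℝ)⁻¹ : ℂ) * Q j, ?_, fun y => ?_⟩
  · refine MvPolynomial.totalDegree_finsetSum_le fun j hj => ?_
    refine (MvPolynomial.totalDegree_mul _ _).trans ?_
    have h1 := hQ j
    have h2 := Finset.mem_range.1 hj
    rw [MvPolynomial.totalDegree_C]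
    omega
  · rw [taylor, map_sum]
    exact Finset.sum_congr rfl fun j _ => by simp [h j y]

theorem isPolyDegLE_taylor (k : ℕ) (u : TestFn N) (x : RN N) :
    IsPolyDegLE N (k - 1) fun y => taylor k u x (y - x) := by
  obtain ⟨Q, hQ, h⟩ := exists_taylor_eq_eval k u x
  simpa only [h] using isPolyDegLE_eval _ Q hQ

variable {φ : RN N → ℝ}

theorem avg_apply_smul (hφ : GoodPhi φ) {t : ℝ} (ht : 0 < t) (u : TestFn N) (x : RN N) :
    avg φ t u x = ∫ z in closedBall 0 1, (φ z : ℂ) * u (x - t • z) := by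
  rw [avg_apply hφ ht, setIntegral_eq_integral_of_forall_compl_eq_zero (fun z hz => by
    rw [hφ.eq_zero (by simpa using hz)]; simp)]
  have h := Measure.integral_comp_inv_smul (volume : Measure (RN N))
    (fun z => (φ z : ℂ) * u (x - t • z)) t
  simp only [smul_inv_smul₀ ht.ne', finrank_euclideanSpace, Fintype.card_fin,
    abs_of_pos (pow_pos ht N)] at h
  have h2 : ∫ z, (dil φ t z : ℂ) * u (x - z) =
      (t ^ N)⁻¹ • ∫ z, (φ (t⁻¹ • z) : ℂ) * u (x - z) := by
    rw [← integral_smul]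
    refine integral_congr_ae (Eventually.of_forall fun z => ?_)
    simp only [dil, Complex.real_smul]
    push_cast
    ring
  rw [h2, h, smul_smul, inv_mul_cancel₀ (by positivity), one_smul]

theorem continuous_osc (hφ : GoodPhi φ) (k : ℕ) (u : TestFn N) :
    Continuous fun z : Ioi (0 : ℝ) × RN N => osc φ z.1 k u z.2 := by
  induction k with
  | zero => exact (continuous u).comp continuous_snd
  | succ k ih =>
    have hhalf : Continuous fun t : Ioi (0 : ℝ) => (⟨t / 2, half_pos (mem_Ioi.1 t.2)⟩ : Ioi (0 : ℝ)) :=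
      Continuous.subtype_mk (by fun_prop) _
    have h1 : (fun z : Ioi (0 : ℝ) × RN N => osc φ z.1 (k + 1) u z.2) = fun z =>
        osc φ (z.1 / 2) k u z.2 -
          ∫ y in closedBall 0 1, (φ y : ℂ) * osc φ (z.1 / 2) k u (z.2 - (z.1 : ℝ) • y) := by
      funext z
      rw [osc_succ, ← avg_apply_smul hφ z.1.2]
      rfl
    rw [h1]
    refine (ih.comp ((hhalf.comp continuous_fst).prodMk continuous_snd)).sub ?_
    have : LocallyCompactSpace (Ioi (0 : ℝ)) := isOpen_Ioi.locallyCompactSpace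
    refine continuous_parametric_integral_of_continuous
      (f := fun (z : Ioi (0 : ℝ) × RN N) y =>
        (φ y : ℂ) * osc φ (z.1 / 2) k u (z.2 - (z.1 : ℝ) • y)) ?_ (isCompact_closedBall 0 1)
    refine (Complex.continuous_ofReal.comp (hφ.smooth.continuous.comp continuous_snd)).mul ?_
    exact ih.comp (f := fun q : (Ioi (0 : ℝ) × RN N) × RN N =>
      ((⟨q.1.1 / 2, half_pos (mem_Ioi.1 q.1.1.2)⟩ : Ioi (0 : ℝ)), q.1.2 - (q.1.1 : ℝ) • q.2))
      ((hhalf.comp (by fun_prop)).prodMk (by fun_prop))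

theorem continuous_taylor_osc (hφ : GoodPhi φ) (l k : ℕ) (f : TestFn N) :
    Continuous fun z : (RN N × Ioi (0 : ℝ)) × RN N =>
      taylor k ((1 - osc φ z.1.2 l) f) z.1.1 (z.2 - z.1.1) := by
  have key : ∀ (j : ℕ) (f : TestFn N), Continuous fun z : (RN N × Ioi (0 : ℝ)) × RN N =>
      (dirD (z.2 - z.1.1) ^ j) ((1 - osc φ z.1.2 l) f) z.1.1 := by
    intro j
    induction j with
    | zero =>
      intro f
      change Continuous fun z : (RN N × Ioi (0 : ℝ)) × RN N => f z.1.1 - osc φ z.1.2 l f z.1.1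
      exact ((continuous f).comp (by fun_prop)).sub ((continuous_osc hφ l f).comp
        (f := fun z : (RN N × Ioi (0 : ℝ)) × RN N => (z.1.2, z.1.1)) (by fun_prop))
    | succ j ih =>
      intro f
      simp only [dirD_pow_succ_apply]
      refine continuous_finsetSum _ fun i _ => Continuous.mul ?_ ?_
      · exact Complex.continuous_ofReal.comp (by fun_prop)
      · have hc : ∀ t : ℝ, D i ((1 - osc φ t l) f) = (1 - osc φ t l) (D i f) := fun t =>
          LinearMap.congr_fun (one_sub_comm (D_osc_comm i t l)).eq f
        simp only [hc]
        exact ih (D i f)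
  exact continuous_finsetSum _ fun j _ => continuous_const.mul (key j f)

end TestFn

/-- The (unnormalised) mean of `g` over the ball of radius `8r` around `y`. -/
def mean (g : RN N → ℝ≥0∞) (r : ℝ) (y : RN N) : ℝ≥0∞ :=
  ENNReal.ofReal (1 / r ^ N) * ∫⁻ z in closedBall y (8 * r), g z

namespace TestFn

variable {φ : RN N → ℝ}

theorem exists_norm_avg_le_mean (hφ : GoodPhi φ) {q : ℝ} (hq0 : 0 < q) (hq1 : q ≤ 1) {m : ℕ}
    (hqm : N / q - N < m) : ∃ K : ℝ, 0 < K ∧ ∀ (u : TestFn N) (G : RN N → ℝ≥0∞),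
    (∀ z, ∀ s ∈ Ioo (0 : ℝ) 1, ‖avg φ s u z‖ₑ ≤ G z) → ∀ (y z : RN N) (r s : ℝ),
    s ∈ Ioo (0 : ℝ) 1 → 0 < r → r ≤ 2 ^ (m + 1) * s → dist z y + 4 * s ≤ 8 * r →
    mean (fun z => G z ^ q) r y ≠ ∞ →
    ‖avg φ s u z‖ ≤ K * (mean (fun z => G z ^ q) r y ^ (1 / q)).toReal := by
  obtain ⟨C, hC, h⟩ := exists_avg_rpow_le hφ hq0 hq1 hqm
  refine ⟨(C * (2 ^ (m + 1)) ^ N) ^ (1 / q), by positivity, fun u G hG y z r s hs hr hrs hd hfin => ?_⟩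
  have hs0 := hs.1
  have h1 : ‖avg φ s u z‖ₑ ^ q ≤
      ENNReal.ofReal (C * (2 ^ (m + 1)) ^ N) * mean (fun z => G z ^ q) r y := by
    refine (h u G hG z s hs).trans ?_
    rw [mean, ← mul_assoc, ← ENNReal.ofReal_mul (by positivity)]
    refine mul_le_mul' (ENNReal.ofReal_le_ofReal ?_)
      (lintegral_mono_set (closedBall_subset_closedBall' (by linarith)))
    rw [mul_one_div, div_le_div_iff₀ (by positivity) (by positivity), mul_assoc, ← mul_pow]
    gcongr
  have h2 : ‖avg φ s u z‖ₑ ≤ ENNReal.ofReal ((C * (2 ^ (m + 1)) ^ N) ^ (1 / q)) *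
      mean (fun z => G z ^ q) r y ^ (1 / q) := by
    rw [← ENNReal.ofReal_rpow_of_nonneg (by positivity) (by positivity),
      ← ENNReal.mul_rpow_of_nonneg _ _ (by positivity : 0 ≤ 1 / q)]
    rwa [one_div, ENNReal.le_rpow_inv_iff hq0]
  have h3 := ENNReal.toReal_mono (ENNReal.mul_ne_top ENNReal.ofReal_ne_top
    (ENNReal.rpow_ne_top_of_nonneg (by positivity) hfin)) h2
  rwa [ENNReal.toReal_mul, ENNReal.toReal_ofReal (by positivity), toReal_enorm] at h3

/-- Approximation of `f` by the Taylor polynomials of its smoothing `(1 - osc φ t (m + 1)) f`. -/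
theorem exists_enorm_sub_taylor_le (hφ : GoodPhi φ) {q : ℝ} (hq0 : 0 < q) (hq1 : q ≤ 1) {m : ℕ}
    (hqm : N / q - N < m) : ∃ K : ℝ, 0 < K ∧ ∀ (f : TestFn N) (G : RN N → ℝ≥0∞),
    (∀ w : List (Fin N), w.length = m → ∀ z, ∀ s ∈ Ioo (0 : ℝ) 1,
      ‖avg φ s (DW w f) z‖ₑ ≤ G z) → ∀ x, ∀ t ∈ Ioo (0 : ℝ) 1, ∀ y ∈ ball x t,
    ‖f y - taylor m ((1 - osc φ t (m + 1)) f) x (y - x)‖ₑ ≤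
      ENNReal.ofReal K * ∑' n : ℕ, ENNReal.ofReal ((t / 2 ^ n) ^ m) *
        mean (fun z => G z ^ q) (t / 2 ^ n) y ^ (1 / q) := by
  obtain ⟨K, hK, hI⟩ := exists_norm_avg_le_mean hφ hq0 hq1 hqm
  set K₁ : ℝ := N ^ m * ((∑ k ∈ Finset.range (m + 1), 2 ^ k) * K)
  set K₂ : ℝ := N ^ m * (2 * K)
  have hK₁ : 0 ≤ K₁ := by positivity
  have hK₂ : 0 ≤ K₂ := by positivity
  refine ⟨K₁ + K₂ + 1, by positivity, fun f G hG x t ht y hy => ?_⟩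
  have ht0 := ht.1
  have hyx : dist y x < t := hy
  have hq' : 0 < 1 / q := by positivity
  set μ : ℕ → ℝ≥0∞ := fun n => mean (fun z => G z ^ q) (t / 2 ^ n) y with hμ
  by_cases hfin : ∃ n, μ n = ∞
  · obtain ⟨n, hn⟩ := hfin
    have : ∑' n : ℕ, ENNReal.ofReal ((t / 2 ^ n) ^ m) * μ n ^ (1 / q) = ∞ := by
      refine ENNReal.tsum_eq_top_of_eq_top ⟨n, ?_⟩
      rw [hn, ENNReal.top_rpow_of_pos hq', ENNReal.mul_top]
      have : 0 < (t / 2 ^ n) ^ m := by positivity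
      simpa using this
    rw [this, ENNReal.mul_top (by simp; positivity)]
    exact le_top
  push Not at hfin
  set b : ℕ → ℝ := fun n => (μ n ^ (1 / q)).toReal with hb
  have hb0 : ∀ n, 0 ≤ b n := fun n => ENNReal.toReal_nonneg
  have htn : ∀ n : ℕ, t / 2 ^ n ∈ Ioo (0 : ℝ) 1 := fun n =>
    ⟨by positivity, (div_le_self ht0.le (one_le_pow₀ one_le_two)).trans_lt ht.2⟩
  set F : TestFn N := (1 - osc φ t (m + 1)) f with hF
  have hsplit : ∀ u : TestFn N, (1 - osc φ t (m + 1)) u =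
      ∑ k ∈ Finset.range (m + 1), osc φ t k (avg φ (t / 2 ^ k) u) := by
    intro u
    ext z
    have h := reproducing_apply (φ := φ) t m 0 u z
    simp only [Finset.range_zero, Finset.sum_empty, add_zero, pow_zero, div_one] at h
    simp only [AddSubmonoidClass.coe_finsetSum, Finset.sum_apply]
    change u z - osc φ t (m + 1) u z = _
    rw [sub_eq_iff_eq_add]
    exact h
  have hT : ‖F y - taylor m F x (y - x)‖ ≤ K₁ * (t ^ m * b 0) := by
    have hw : ∀ w : List (Fin N), w.length = m → ∀ z ∈ closedBall x t, ‖DW w F z‖ ≤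
        (∑ k ∈ Finset.range (m + 1), 2 ^ k) * K * b 0 := by
      intro w hw z hz
      have hc : DW w F = (1 - osc φ t (m + 1)) (DW w f) :=
        LinearMap.congr_fun (one_sub_comm (DW_osc_comm w t (m + 1))).eq f
      rw [hc, hsplit, Finset.sum_mul, Finset.sum_mul]
      rw [AddSubmonoidClass.coe_finsetSum, Finset.sum_apply]
      refine norm_sum_le_of_le _ fun k hk => ?_
      rw [mul_assoc]
      refine norm_osc_le_two_pow hφ ht0 k _ fun z' hz' => ?_
      have hk' : k ≤ m + 1 := (Finset.mem_range.1 hk).le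
      refine hI _ G (hG w hw) y z' _ (t / 2 ^ k) (htn k) (htn 0).1 ?_ ?_ (hfin 0)
      · rw [pow_zero, div_one, mul_div_assoc', le_div_iff₀ (by positivity), mul_comm]
        gcongr
        · norm_num
      · rw [mem_closedBall] at hz hz'
        have h1 : t / 2 ^ k ≤ t := div_le_self ht0.le (one_le_pow₀ one_le_two)
        have h2 := dist_triangle4 z' z x y
        rw [dist_comm x y] at h2
        rw [pow_zero, div_one]
        linarith
    refine (norm_sub_taylor_le m F x y (ball_subset_closedBall hy) hw).trans ?_
    have h1 : ‖y - x‖ ≤ t := by rw [← dist_eq_norm]; exact hyx.le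
    calc _ ≤ (N * t) ^ m * ((∑ k ∈ Finset.range (m + 1), 2 ^ k) * K * b 0) := by
          have := hb0 0
          gcongr
      _ = _ := by simp only [K₁]; ring
  have hR : ∀ n, ‖osc φ t (m + 1) f y‖ ≤
      ∑ j ∈ Finset.range n, K₂ * ((t / 2 ^ j) ^ m * b j) + ‖osc φ (t / 2 ^ n) (m + 1) f y‖ := by
    intro n
    have h1 : osc φ t (m + 1) f y = ∑ j ∈ Finset.range n, osc φ (t / 2 ^ (j + 1)) m
        (avg φ (t / 2 ^ (j + m + 1)) f - avg φ (t / 2 ^ j) f) y +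
        osc φ (t / 2 ^ n) (m + 1) f y := by
      have h2 := reproducing_apply (φ := φ) t m n f y
      have h3 : f y - osc φ t (m + 1) f y = _ := congrArg (fun u : TestFn N => u y) (hsplit f)
      simp only [AddSubmonoidClass.coe_finsetSum, Finset.sum_apply] at h3
      rw [← h3] at h2
      linear_combination h2
    rw [h1]
    refine (norm_add_le _ _).trans (add_le_add (norm_sum_le_of_le _ fun j _ => ?_) le_rfl)
    refine (norm_osc_le hφ (htn (j + 1)).1 m _ (B := 2 * K * b j)
      (by have := hb0 j; positivity) fun w hw z hz => ?_).trans ?_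
    · rw [map_sub]
      have hc : ∀ s, DW w (avg φ s f) = avg φ s (DW w f) := fun s =>
        LinearMap.congr_fun (DW_avg_comm w s).eq f
      rw [hc, hc]
      change ‖avg φ _ (DW w f) z - avg φ _ (DW w f) z‖ ≤ _
      have hz' : dist z y ≤ t / 2 ^ j := by
        rw [mem_closedBall] at hz
        refine hz.trans (le_of_eq ?_)
        rw [pow_succ]; field_simp
      have htj := (htn j).1
      have hle : t / 2 ^ (j + m + 1) ≤ t / 2 ^ j := by
        gcongr
        · norm_num
        · omega
      have e1 := hI _ G (hG w hw) y z (t / 2 ^ j) _ (htn (j + m + 1)) htj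
        (le_of_eq (by rw [add_assoc, pow_add 2 j]; field_simp)) (by linarith) (hfin j)
      have e2 := hI _ G (hG w hw) y z (t / 2 ^ j) _ (htn j) htj
        (le_mul_of_one_le_left htj.le (one_le_pow₀ one_le_two)) (by linarith) (hfin j)
      refine (norm_sub_le _ _).trans ?_
      linarith
    · have h2 : t / 2 ^ (j + 1) ≤ t / 2 ^ j := by
        gcongr
        · norm_num
        · omega
      have h3 := (htn (j + 1)).1
      have := hb0 j
      calc _ ≤ (N * (t / 2 ^ j)) ^ m * (2 * K * b j) := by gcongr
        _ = _ := by simp only [K₂]; ring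
  have hfy : ∀ v : ℂ, f y - v = (F y - v) + osc φ t (m + 1) f y := fun v => by
    have : F y = f y - osc φ t (m + 1) f y := rfl
    rw [this]; ring
  have hlim := ((tendsto_osc hφ ht0 (Nat.succ_ne_zero m) f y).const_add
    ((K₁ + K₂ + 1) * (∑' n : ℕ, ENNReal.ofReal ((t / 2 ^ n) ^ m) * μ n ^ (1 / q)).toReal))
  by_cases hsum : ∑' n : ℕ, ENNReal.ofReal ((t / 2 ^ n) ^ m) * μ n ^ (1 / q) = ∞
  · rw [hsum, ENNReal.mul_top (by simp; positivity)]
    exact le_top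
  rw [← ENNReal.ofReal_toReal hsum, ← ENNReal.ofReal_mul (by positivity), ← ofReal_norm]
  refine ENNReal.ofReal_le_ofReal ?_
  rw [add_zero] at hlim
  refine ge_of_tendsto' hlim fun n => ?_
  rw [hfy]
  refine (norm_add_le _ _).trans ((add_le_add hT (hR n)).trans ?_)
  rw [← add_assoc]
  refine add_le_add ?_ le_rfl
  have hpart : ∀ s : Finset ℕ, ∑ j ∈ s, (t / 2 ^ j) ^ m * b j ≤
      (∑' n : ℕ, ENNReal.ofReal ((t / 2 ^ n) ^ m) * μ n ^ (1 / q)).toReal := by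
    intro s
    have e : ∑ j ∈ s, (t / 2 ^ j) ^ m * b j =
        (∑ j ∈ s, ENNReal.ofReal ((t / 2 ^ j) ^ m) * μ j ^ (1 / q)).toReal := by
      rw [ENNReal.toReal_sum fun j _ => ENNReal.mul_ne_top ENNReal.ofReal_ne_top
        (ENNReal.rpow_ne_top_of_nonneg hq'.le (hfin j))]
      refine Finset.sum_congr rfl fun j _ => ?_
      have := (htn j).1
      rw [ENNReal.toReal_mul, ENNReal.toReal_ofReal (by positivity)]
    rw [e]
    exact ENNReal.toReal_mono hsum (ENNReal.sum_le_tsum s)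
  have p1 := hpart {0}
  have p2 := hpart (Finset.range n)
  rw [Finset.sum_singleton, pow_zero, div_one] at p1
  rw [← Finset.mul_sum]
  have p3 := mul_le_mul_of_nonneg_left p1 hK₁
  have p4 := mul_le_mul_of_nonneg_left p2 hK₂
  have p5 := (ENNReal.toReal_nonneg
    (a := ∑' n : ℕ, ENNReal.ofReal ((t / 2 ^ n) ^ m) * μ n ^ (1 / q)))
  linarith

end TestFn

theorem measurable_setLIntegral_closedBall {g : RN N → ℝ≥0∞} (hg : Measurable g) (R : ℝ) :
    Measurable fun y => ∫⁻ z in closedBall y R, g z := by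
  have hS : MeasurableSet {p : RN N × RN N | dist p.2 p.1 ≤ R} :=
    measurableSet_le (by fun_prop) (by fun_prop)
  have h := ((hg.comp measurable_snd).indicator hS).lintegral_prod_right' (ν := volume)
  convert h using 2 with y
  rw [← lintegral_indicator measurableSet_closedBall]
  rfl

theorem measurable_mean {g : RN N → ℝ≥0∞} (hg : Measurable g) (r : ℝ) :
    Measurable (mean g r) :=
  (measurable_setLIntegral_closedBall hg _).const_mul _

/-- Tonelli's theorem for integrals over moving balls. -/
theorem setLIntegral_setLIntegral_closedBall_le {g : RN N → ℝ≥0∞} (hg : Measurable g)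
    (x : RN N) {t R : ℝ} :
    ∫⁻ y in ball x t, ∫⁻ z in closedBall y R, g z ≤
      volume (closedBall (0 : RN N) R) * ∫⁻ z in closedBall x (t + R), g z := by
  have hS : MeasurableSet {p : RN N × RN N | dist p.2 p.1 ≤ R} :=
    measurableSet_le (by fun_prop) (by fun_prop)
  have h1 : ∀ y ∈ ball x t, ∫⁻ z in closedBall y R, g z ≤
      ∫⁻ z in closedBall x (t + R), {p : RN N × RN N | dist p.2 p.1 ≤ R}.indicator
        (fun p => g p.2) (y, z) := by
    intro y hy
    rw [mem_ball] at hy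
    have hsub : closedBall y R ⊆ closedBall x (t + R) :=
      closedBall_subset_closedBall' (by linarith)
    have e : ∀ z, {p : RN N × RN N | dist p.2 p.1 ≤ R}.indicator (fun p => g p.2) (y, z) =
        (closedBall y R).indicator g z := fun z => rfl
    simp only [e]
    rw [lintegral_indicator measurableSet_closedBall, Measure.restrict_restrict
      measurableSet_closedBall, inter_eq_self_of_subset_left hsub]
  refine (setLIntegral_mono' measurableSet_ball h1).trans ((setLIntegral_le_lintegral _ _).trans ?_)
  rw [lintegral_lintegral_swap (f := fun y z => {p : RN N × RN N | dist p.2 p.1 ≤ R}.indicator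
    (fun p => g p.2) (y, z)) ((hg.comp measurable_snd).indicator hS).aemeasurable,
    ← lintegral_const_mul _ hg]
  refine lintegral_mono fun z => le_of_eq ?_
  have e : ∀ y, {p : RN N × RN N | dist p.2 p.1 ≤ R}.indicator (fun p => g p.2) (y, z) =
      (closedBall z R).indicator (fun _ => g z) y := by
    intro y
    simp only [indicator, mem_ofPred_eq, mem_closedBall, dist_comm]
  simp only [e]
  rw [lintegral_indicator measurableSet_closedBall, setLIntegral_const, mul_comm,
    Measure.addHaar_closedBall_center]

theorem tsum_two_rpow_neg_ne_top {ε : ℝ} (hε : 0 < ε) :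
    ∑' n : ℕ, (2 : ℝ≥0∞) ^ (-(n * ε)) ≠ ∞ := by
  have h : ∀ n : ℕ, (2 : ℝ≥0∞) ^ (-(n * ε)) = ((2 : ℝ≥0∞) ^ (-ε)) ^ n := fun n => by
    rw [← ENNReal.rpow_natCast, ← ENNReal.rpow_mul]
    congr 1
    ring
  simp only [h]
  rw [ENNReal.tsum_geometric, ENNReal.inv_ne_top]
  have h1 : (2 : ℝ≥0∞) ^ (-ε) < 1 :=
    ENNReal.rpow_lt_one_of_one_lt_of_neg (by norm_num) (by linarith)
  exact (tsub_pos_of_lt h1).ne'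

theorem tsum_mul_rpow_le {α : ℝ} (hα : 0 < α) (c d : ℕ → ℝ≥0∞) :
    (∑' n, c n * d n) ^ α ≤ (∑' n, c n) ^ α * ∑' n, d n ^ α := by
  have h1 : ∀ n, d n ≤ (∑' k, d k ^ α) ^ α⁻¹ := fun n => by
    rw [ENNReal.le_rpow_inv_iff hα]
    exact ENNReal.le_tsum n
  calc (∑' n, c n * d n) ^ α ≤ (∑' n, c n * (∑' k, d k ^ α) ^ α⁻¹) ^ α := by
        gcongr with n
        exact h1 n
    _ = _ := by
        rw [ENNReal.tsum_mul_right, ENNReal.mul_rpow_of_nonneg _ _ hα.le,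
          ENNReal.rpow_inv_rpow hα.ne']

theorem exists_setLIntegral_tsum_mean_le {q α : ℝ} {m : ℕ} (hq0 : 0 < q) (hqα : q ≤ α)
    (hδ : 0 < m - N / q + N / α) : ∃ C : ℝ≥0∞, C ≠ ∞ ∧ ∀ g : RN N → ℝ≥0∞, Measurable g →
    ∀ x t, 0 < t → ∫⁻ y in ball x t, (∑' n : ℕ, ENNReal.ofReal ((t / 2 ^ n) ^ m) *
      mean g (t / 2 ^ n) y ^ (1 / q)) ^ α ≤ C * (ENNReal.ofReal (t ^ m) ^ α * ENNReal.ofReal (t ^ N)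
        * (ENNReal.ofReal (1 / t ^ N) * ∫⁻ z in closedBall x (9 * t), g z) ^ (α / q)) := by
  have hα : 0 < α := hq0.trans_le hqα
  set δ : ℝ := m - N / q + N / α with hδdef
  set ε : ℝ := δ / 2 with hε
  have hε0 : 0 < ε := half_pos hδ
  have h20 : (2 : ℝ≥0∞) ≠ 0 := two_ne_zero
  have h2t : (2 : ℝ≥0∞) ≠ ∞ := ENNReal.ofNat_ne_top
  set V : ℝ≥0∞ := volume (closedBall (0 : RN N) 8)
  have hV : V ≠ ∞ := measure_closedBall_lt_top.ne
  refine ⟨(∑' n : ℕ, (2 : ℝ≥0∞) ^ (-(n * ε))) ^ α * (V * ∑' n : ℕ, (2 : ℝ≥0∞) ^ (-(n * (α * ε)))),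
    ?_, fun g hg x t ht => ?_⟩
  · refine ENNReal.mul_ne_top (ENNReal.rpow_ne_top_of_nonneg hα.le (tsum_two_rpow_neg_ne_top hε0))
      (ENNReal.mul_ne_top hV (tsum_two_rpow_neg_ne_top (by positivity)))
  set A : ℝ≥0∞ := ENNReal.ofReal (1 / t ^ N) * ∫⁻ z in closedBall x (9 * t), g z with hA
  have htn : ∀ n : ℕ, 0 < t / 2 ^ n := fun n => by positivity
  have hpow : ∀ n k : ℕ, ENNReal.ofReal ((2 ^ n) ^ k) = (2 : ℝ≥0∞) ^ ((n : ℝ) * k) := by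
    intro n k
    rw [← pow_mul, ENNReal.ofReal_pow two_pos.le, ← Nat.cast_mul, ENNReal.rpow_natCast]
    simp
  set d : ℕ → RN N → ℝ≥0∞ := fun n y =>
    2 ^ ((n : ℝ) * ε - n * m) * mean g (t / 2 ^ n) y ^ (1 / q) with hd
  have hpt : ∀ y, (∑' n : ℕ, ENNReal.ofReal ((t / 2 ^ n) ^ m) * mean g (t / 2 ^ n) y ^ (1 / q)) ^ α
      ≤ ENNReal.ofReal (t ^ m) ^ α *
        ((∑' n : ℕ, (2 : ℝ≥0∞) ^ (-(n * ε))) ^ α * ∑' n, d n y ^ α) := by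
    intro y
    have e : ∀ n : ℕ, ENNReal.ofReal ((t / 2 ^ n) ^ m) * mean g (t / 2 ^ n) y ^ (1 / q) =
        ENNReal.ofReal (t ^ m) * ((2 : ℝ≥0∞) ^ (-(n * ε)) * d n y) := by
      intro n
      rw [hd, ← mul_assoc ((2 : ℝ≥0∞) ^ _), ← ENNReal.rpow_add _ _ h20 h2t, ← mul_assoc, div_pow,
        div_eq_mul_inv, ENNReal.ofReal_mul (by positivity), ENNReal.ofReal_inv_of_pos (by positivity),
        hpow, ← ENNReal.rpow_neg]
      congr 4
      ring
    simp only [e]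
    rw [ENNReal.tsum_mul_left, ENNReal.mul_rpow_of_nonneg _ _ hα.le]
    exact mul_le_mul' le_rfl (tsum_mul_rpow_le hα _ _)
  have hmean : ∀ n : ℕ, ∀ y ∈ ball x t, mean g (t / 2 ^ n) y ≤ 2 ^ ((n : ℝ) * N) * A := by
    intro n y hy
    rw [mem_ball] at hy
    have h1 : t / 2 ^ n ≤ t := div_le_self ht.le (one_le_pow₀ one_le_two)
    rw [hA, ← mul_assoc, ← hpow, ← ENNReal.ofReal_mul (by positivity)]
    refine mul_le_mul' (ENNReal.ofReal_le_ofReal (le_of_eq ?_))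
      (lintegral_mono_set (closedBall_subset_closedBall' (by linarith)))
    rw [div_pow]; field_simp
  have hint : ∀ n : ℕ, ∫⁻ y in ball x t, mean g (t / 2 ^ n) y ≤ V * (ENNReal.ofReal (t ^ N) * A) := by
    intro n
    have h1 : t / 2 ^ n ≤ t := div_le_self ht.le (one_le_pow₀ one_le_two)
    have h2 : volume (closedBall (0 : RN N) (8 * (t / 2 ^ n))) =
        ENNReal.ofReal ((t / 2 ^ n) ^ N) * V := by
      have := Measure.addHaar_closedBall_mul (volume : Measure (RN N)) 0 (htn n).le
        (s := 8) (by norm_num)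
      rwa [mul_comm, finrank_euclideanSpace, Fintype.card_fin] at this
    simp only [mean]
    rw [lintegral_const_mul _ (measurable_setLIntegral_closedBall hg _)]
    refine (mul_le_mul' le_rfl ((setLIntegral_setLIntegral_closedBall_le hg x).trans
      (mul_le_mul' le_rfl (lintegral_mono_set (closedBall_subset_closedBall
        (by linarith : t + 8 * (t / 2 ^ n) ≤ 9 * t)))))).trans (le_of_eq ?_)
    have e1 : ENNReal.ofReal (1 / (t / 2 ^ n) ^ N) * ENNReal.ofReal ((t / 2 ^ n) ^ N) = 1 := by
      have := htn n
      rw [← ENNReal.ofReal_mul (by positivity), one_div_mul_cancel (by positivity),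
        ENNReal.ofReal_one]
    have e2 : ENNReal.ofReal (t ^ N) * ENNReal.ofReal (1 / t ^ N) = 1 := by
      rw [← ENNReal.ofReal_mul (by positivity), mul_one_div_cancel (by positivity),
        ENNReal.ofReal_one]
    rw [h2, hA, ← mul_assoc (ENNReal.ofReal (t ^ N)), e2, one_mul, ← mul_assoc, ← mul_assoc, e1,
      one_mul]
  have hαq : 0 ≤ α / q - 1 := by
    rw [sub_nonneg, le_div_iff₀ hq0]; linarith
  have hdint : ∀ n : ℕ, ∫⁻ y in ball x t, d n y ^ α ≤
      2 ^ (-((n : ℝ) * (α * ε))) * (V * (ENNReal.ofReal (t ^ N) * A ^ (α / q))) := by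
    intro n
    have h1 : ∀ y ∈ ball x t, d n y ^ α ≤
        (2 ^ (((n : ℝ) * ε - n * m) * α) * (2 ^ ((n : ℝ) * N) * A) ^ (α / q - 1)) *
          mean g (t / 2 ^ n) y := by
      intro y hy
      rw [hd, ENNReal.mul_rpow_of_nonneg _ _ hα.le, ← ENNReal.rpow_mul, ← ENNReal.rpow_mul,
        mul_assoc]
      refine mul_le_mul' le_rfl ?_
      have e : 1 / q * α = (α / q - 1) + 1 := by ring
      rw [e, ENNReal.rpow_add_of_nonneg _ _ hαq zero_le_one, ENNReal.rpow_one]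
      exact mul_le_mul' (ENNReal.rpow_le_rpow (hmean n y hy) hαq) le_rfl
    refine (setLIntegral_mono' measurableSet_ball h1).trans ?_
    rw [lintegral_const_mul _ (measurable_mean hg _)]
    refine (mul_le_mul' le_rfl (hint n)).trans (le_of_eq ?_)
    have e1 : A ^ (α / q) = A ^ (α / q - 1) * A := by
      have := ENNReal.rpow_add_of_nonneg (x := A) _ _ hαq zero_le_one
      rwa [sub_add_cancel, ENNReal.rpow_one] at this
    have e2 : (2 : ℝ≥0∞) ^ (-((n : ℝ) * (α * ε))) =
        2 ^ (((n : ℝ) * ε - n * m) * α) * 2 ^ ((n : ℝ) * N * (α / q - 1)) := by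
      rw [← ENNReal.rpow_add _ _ h20 h2t]
      congr 1
      have : δ = 2 * ε := by rw [hε]; ring
      have h3 : (m : ℝ) = 2 * ε + N / q - N / α := by rw [← this, hδdef]; ring
      rw [h3]
      field_simp
      ring
    rw [ENNReal.mul_rpow_of_nonneg _ _ hαq, ← ENNReal.rpow_mul, e1, e2]
    ring
  calc _ ≤ ∫⁻ y in ball x t, ENNReal.ofReal (t ^ m) ^ α *
        ((∑' n : ℕ, (2 : ℝ≥0∞) ^ (-(n * ε))) ^ α * ∑' n, d n y ^ α) := lintegral_mono hpt
    _ = ENNReal.ofReal (t ^ m) ^ α * ((∑' n : ℕ, (2 : ℝ≥0∞) ^ (-(n * ε))) ^ α *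
        ∑' n, ∫⁻ y in ball x t, d n y ^ α) := by
        have hdm : ∀ n, Measurable fun y => d n y ^ α := fun n =>
          (((measurable_mean hg _).pow_const _).const_mul _).pow_const _
        rw [lintegral_const_mul _ ((Measurable.tsum hdm).const_mul _),
          lintegral_const_mul _ (Measurable.tsum hdm),
          lintegral_tsum fun n => (hdm n).aemeasurable]
    _ ≤ ENNReal.ofReal (t ^ m) ^ α * ((∑' n : ℕ, (2 : ℝ≥0∞) ^ (-(n * ε))) ^ α *
        ∑' n : ℕ, 2 ^ (-((n : ℝ) * (α * ε))) * (V * (ENNReal.ofReal (t ^ N) * A ^ (α / q)))) := by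
        gcongr with n
        exact hdint n
    _ = _ := by
        rw [ENNReal.tsum_mul_right]
        ring

/-- Local Hardy–Littlewood maximal function (with dilated balls). -/
def localMax (g : RN N → ℝ≥0∞) (x : RN N) : ℝ≥0∞ :=
  ⨆ r ∈ Ioo (0 : ℝ) 1, ENNReal.ofReal (1 / r ^ N) * ∫⁻ z in closedBall x (9 * r), g z

theorem volume_closedBall_mul (x : RN N) {r s : ℝ} (hr : 0 ≤ r) (hs : 0 ≤ s) :
    volume (closedBall x (s * r)) = ENNReal.ofReal (r ^ N) * volume (closedBall (0 : RN N) s) := by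
  rw [Measure.addHaar_closedBall_center, mul_comm s r, Measure.addHaar_closedBall_mul _ _ hr hs,
    finrank_euclideanSpace, Fintype.card_fin]

/-- Weak-type estimate for the local maximal function. -/
theorem mul_volume_lt_localMax_le (g : RN N → ℝ≥0∞) (l : ℝ≥0∞) :
    l * volume {x | l < localMax g x} ≤ volume (closedBall (0 : RN N) 45) * ∫⁻ z, g z := by
  set E := {x | l < localMax g x} with hE
  have hex : ∀ x ∈ E, ∃ r ∈ Ioo (0 : ℝ) 1, ENNReal.ofReal (r ^ N) * l ≤
      ∫⁻ z in closedBall x (9 * r), g z := by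
    intro x hx
    have hx' : l < localMax g x := hx
    simp only [localMax, lt_iSup_iff] at hx'
    obtain ⟨r, hr, hx'⟩ := hx'
    have hr0 := hr.1
    refine ⟨r, hr, ?_⟩
    calc _ ≤ ENNReal.ofReal (r ^ N) * (ENNReal.ofReal (1 / r ^ N) *
          ∫⁻ z in closedBall x (9 * r), g z) := by gcongr
      _ = _ := by
        rw [← mul_assoc, ← ENNReal.ofReal_mul (by positivity), mul_one_div_cancel (by positivity),
          ENNReal.ofReal_one, one_mul]
  choose! r hr hint using hex
  obtain ⟨u, huE, hdisj, hcov⟩ := Vitali.exists_disjoint_subfamily_covering_enlargement_closedBall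
    E id (fun x => 9 * r x) 9 (fun x hx => by linarith [(hr x hx).2]) 5 (by norm_num)
  have hdisj' : u.PairwiseDisjoint fun a => closedBall a (9 * r a) := hdisj
  have hcount : u.Countable := hdisj.countable_of_nonempty_interior fun x hx => by
    refine ⟨x, ball_subset_interior_closedBall (mem_ball_self ?_)⟩
    have := (hr x (huE hx)).1
    positivity
  have hsub : E ⊆ ⋃ x ∈ u, closedBall x (45 * r x) := by
    intro x hx
    obtain ⟨b, hb, h⟩ := hcov x hx
    have h1 : x ∈ closedBall (id x) (9 * r x) :=
      mem_closedBall_self (by have := (hr x hx).1; positivity)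
    refine mem_biUnion hb ?_
    have := h h1
    rwa [← mul_assoc, show (5 : ℝ) * 9 = 45 by norm_num] at this
  have := hcount.to_subtype
  calc l * volume E ≤ l * ∑' x : u, volume (closedBall (x : RN N) (45 * r x)) := by
        gcongr
        exact (measure_mono hsub).trans (measure_biUnion_le _ hcount _)
    _ = ∑' x : u, volume (closedBall (0 : RN N) 45) * (ENNReal.ofReal (r x ^ N) * l) := by
        rw [← ENNReal.tsum_mul_left]
        refine tsum_congr fun x => ?_
        rw [volume_closedBall_mul _ (hr x (huE x.2)).1.le (by norm_num)]
        ring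
    _ ≤ ∑' x : u, volume (closedBall (0 : RN N) 45) * ∫⁻ z in closedBall (x : RN N) (9 * r x), g z := by
        gcongr with x
        exact hint x (huE x.2)
    _ = volume (closedBall (0 : RN N) 45) * ∫⁻ z in ⋃ x ∈ u, closedBall x (9 * r x), g z := by
        rw [ENNReal.tsum_mul_left,
          lintegral_biUnion hcount (fun _ _ => measurableSet_closedBall) hdisj']
    _ ≤ _ := by
        exact mul_le_mul' le_rfl (setLIntegral_le_lintegral _ _)

theorem localMax_le_add {g h : RN N → ℝ≥0∞} {s : ℝ≥0∞} (hgh : ∀ x, g x ≤ h x + s)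
    (x : RN N) : localMax g x ≤ localMax h x + s * volume (closedBall (0 : RN N) 9) := by
  refine iSup₂_le fun r hr => ?_
  have hr0 := hr.1
  have h1 : ∫⁻ z in closedBall x (9 * r), g z ≤
      (∫⁻ z in closedBall x (9 * r), h z) + s * volume (closedBall x (9 * r)) := by
    refine (lintegral_mono hgh).trans (le_of_eq ?_)
    rw [lintegral_add_right _ measurable_const, setLIntegral_const]
  refine (mul_le_mul' le_rfl h1).trans ?_
  rw [mul_add]
  refine add_le_add (le_iSup₂ (f := fun r (_ : r ∈ Ioo (0 : ℝ) 1) =>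
    ENNReal.ofReal (1 / r ^ N) * ∫⁻ z in closedBall x (9 * r), h z) r hr) (le_of_eq ?_)
  rw [volume_closedBall_mul _ hr0.le (by norm_num), mul_left_comm, ← mul_assoc (ENNReal.ofReal _),
    ← ENNReal.ofReal_mul (by positivity), one_div_mul_cancel (by positivity), ENNReal.ofReal_one,
    one_mul]

theorem mul_volume_lt_localMax_le_trunc (g : RN N → ℝ≥0∞) {l : ℝ≥0∞} :
    l * volume {x | l < localMax g x} ≤ 2 * volume (closedBall (0 : RN N) 45) *
      ∫⁻ z, {z | l < 2 * volume (closedBall (0 : RN N) 9) * g z}.indicator g z := by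
  set κ := volume (closedBall (0 : RN N) 9)
  have hκ0 : κ ≠ 0 := (measure_closedBall_pos _ _ (by norm_num)).ne'
  have hκt : κ ≠ ∞ := measure_closedBall_lt_top.ne
  set h : RN N → ℝ≥0∞ := {z | l < 2 * κ * g z}.indicator g with hh
  have h2κ0 : 2 * κ ≠ 0 := mul_ne_zero two_ne_zero hκ0
  have h2κt : 2 * κ ≠ ∞ := ENNReal.mul_ne_top ENNReal.ofNat_ne_top hκt
  have hle : ∀ z, g z ≤ h z + l / (2 * κ) := by
    intro z
    by_cases hz : l < 2 * κ * g z
    · rw [hh, indicator_of_mem (by exact hz)]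
      exact le_self_add
    · refine le_add_left ?_
      rw [ENNReal.le_div_iff_mul_le (Or.inl h2κ0) (Or.inl h2κt), mul_comm]
      exact not_lt.1 hz
  have hsub : {x | l < localMax g x} ⊆ {x | l / 2 < localMax h x} := by
    intro x hx
    by_contra hx'
    have h1 : localMax h x ≤ l / 2 := not_lt.1 hx'
    have h2 : l / (2 * κ) * κ = l / 2 := by
      rw [div_eq_mul_inv, div_eq_mul_inv, ENNReal.mul_inv (Or.inl two_ne_zero)
        (Or.inl ENNReal.ofNat_ne_top), mul_assoc, mul_assoc, ENNReal.inv_mul_cancel hκ0 hκt, mul_one]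
    have h3 := (localMax_le_add hle x).trans (add_le_add h1 h2.le)
    rw [ENNReal.add_halves] at h3
    exact absurd hx (not_lt.2 h3)
  calc l * volume {x | l < localMax g x} ≤ 2 * (l / 2 * volume {x | l / 2 < localMax h x}) := by
        rw [← mul_assoc, ENNReal.mul_div_cancel two_ne_zero ENNReal.ofNat_ne_top]
        gcongr
    _ ≤ _ := by
        rw [mul_assoc]
        exact mul_le_mul' le_rfl (mul_volume_lt_localMax_le h _)

theorem two_rpow_lt_iff {a b : ℝ} : (2 : ℝ≥0∞) ^ a < 2 ^ b ↔ a < b := by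
  constructor
  · intro h
    by_contra! h'
    exact absurd h (not_lt.2 (ENNReal.rpow_le_rpow_of_exponent_le (by norm_num) h'))
  · exact fun h => ENNReal.rpow_lt_rpow_of_exponent_lt ENNReal.one_lt_two ENNReal.ofNat_ne_top h

theorem exists_mem_Ioc_two_rpow {a : ℝ≥0∞} (h0 : a ≠ 0) (ht : a ≠ ∞) :
    ∃ n : ℤ, a ∈ Ioc ((2 : ℝ≥0∞) ^ (n : ℝ)) (2 ^ ((n : ℝ) + 1)) := by
  obtain ⟨n, hn⟩ := ENNReal.exists_mem_Ioc_zpow h0 ht ENNReal.one_lt_two ENNReal.ofNat_ne_top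
  refine ⟨n, ?_⟩
  rw [ENNReal.rpow_intCast, ← Int.cast_one, ← Int.cast_add, ENNReal.rpow_intCast]
  exact hn

theorem rpow_le_tsum_dyadic {ρ : ℝ} (hρ : 0 < ρ) (a : ℝ≥0∞) :
    a ^ ρ ≤ ∑' k : ℤ, {b | (2 : ℝ≥0∞) ^ (k : ℝ) < b}.indicator
      (fun _ => (2 : ℝ≥0∞) ^ (((k : ℝ) + 1) * ρ)) a := by
  rcases eq_or_ne a 0 with rfl | h0
  · simp [hρ]
  rcases eq_or_ne a ∞ with rfl | ht
  · refine le_top.trans ?_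
    calc ∞ = ∑' _n : ℕ, (1 : ℝ≥0∞) := (ENNReal.tsum_const_eq_top_of_ne_zero one_ne_zero).symm
      _ ≤ ∑' n : ℕ, {b | (2 : ℝ≥0∞) ^ (((n : ℤ) : ℝ)) < b}.indicator
          (fun _ => (2 : ℝ≥0∞) ^ ((((n : ℤ) : ℝ) + 1) * ρ)) ∞ := by
        refine ENNReal.tsum_le_tsum fun n => ?_
        rw [indicator_of_mem]
        · refine ENNReal.one_le_rpow (by norm_num) ?_
          push_cast
          positivity
        · exact ENNReal.rpow_lt_top_of_nonneg (by simp) ENNReal.ofNat_ne_top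
      _ ≤ _ := ENNReal.tsum_comp_le_tsum_of_injective (f := fun n : ℕ => (n : ℤ))
          Nat.cast_injective _
  obtain ⟨n, hn⟩ := exists_mem_Ioc_two_rpow h0 ht
  refine le_trans ?_ (ENNReal.le_tsum n)
  rw [indicator_of_mem (by exact hn.1), ENNReal.rpow_mul]
  exact ENNReal.rpow_le_rpow hn.2 hρ.le

theorem exists_tsum_dyadic_le {η : ℝ} (hη : 0 < η) : ∃ C : ℝ≥0∞, C ≠ ∞ ∧ ∀ a : ℝ≥0∞,
    ∑' k : ℤ, {b | (2 : ℝ≥0∞) ^ (k : ℝ) < b}.indicator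
      (fun _ => (2 : ℝ≥0∞) ^ ((k : ℝ) * η)) a ≤ C * a ^ η := by
  refine ⟨∑' n : ℕ, (2 : ℝ≥0∞) ^ (-(n * η)), tsum_two_rpow_neg_ne_top hη, fun a => ?_⟩
  rcases eq_or_ne a 0 with rfl | h0
  · simp
  rcases eq_or_ne a ∞ with rfl | ht
  · rw [ENNReal.top_rpow_of_pos hη, ENNReal.mul_top]
    · exact le_top
    · refine (lt_of_lt_of_le one_pos ?_).ne'
      simpa using ENNReal.le_tsum (f := fun n : ℕ => (2 : ℝ≥0∞) ^ (-(n * η))) 0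
  obtain ⟨n, hn⟩ := exists_mem_Ioc_two_rpow h0 ht
  rw [← (Equiv.subLeft n).tsum_eq]
  rw [← Function.Injective.tsum_eq (g := fun j : ℕ => (j : ℤ)) Nat.cast_injective]
  · rw [← ENNReal.tsum_mul_right]
    refine ENNReal.tsum_le_tsum fun j => (indicator_le_self' (fun _ _ => zero_le) _).trans ?_
    have h1 : (((Equiv.subLeft n) (j : ℤ) : ℤ) : ℝ) * η = -(j * η) + n * η := by
      simp [Equiv.subLeft]
      ring
    rw [h1, ENNReal.rpow_add _ _ two_ne_zero ENNReal.ofNat_ne_top, ENNReal.rpow_mul 2 (n : ℝ)]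
    gcongr
    exact hn.1.le
  · intro j hj
    have h1 : (2 : ℝ≥0∞) ^ (((Equiv.subLeft n) j : ℤ) : ℝ) < a := by
      by_contra h
      exact hj (indicator_of_notMem (by exact h) _)
    have h2 := two_rpow_lt_iff.1 (h1.trans_le hn.2)
    have h3 : n - j < n + 1 := by exact_mod_cast h2
    exact ⟨j.toNat, by simp; omega⟩

/-- The local maximal function is bounded on `L^ρ` for `ρ > 1`. -/
theorem exists_lintegral_localMax_rpow_le {ρ : ℝ} (hρ : 1 < ρ) : ∃ C : ℝ≥0∞, C ≠ ∞ ∧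
    ∀ g : RN N → ℝ≥0∞, Measurable g → ∫⁻ x, localMax g x ^ ρ ≤ C * ∫⁻ x, g x ^ ρ := by
  have hη : 0 < ρ - 1 := by linarith
  obtain ⟨C, hC, hsum⟩ := exists_tsum_dyadic_le hη
  set κ := volume (closedBall (0 : RN N) 9)
  have hκt : 2 * κ ≠ ∞ := ENNReal.mul_ne_top ENNReal.ofNat_ne_top measure_closedBall_lt_top.ne
  set V := volume (closedBall (0 : RN N) 45)
  have hV : V ≠ ∞ := measure_closedBall_lt_top.ne
  refine ⟨2 ^ ρ * (2 * V) * (C * (2 * κ) ^ (ρ - 1)), ?_, fun g hg => ?_⟩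
  · exact ENNReal.mul_ne_top (ENNReal.mul_ne_top (ENNReal.rpow_ne_top_of_nonneg (by linarith)
      ENNReal.ofNat_ne_top) (ENNReal.mul_ne_top ENNReal.ofNat_ne_top hV))
      (ENNReal.mul_ne_top hC (ENNReal.rpow_ne_top_of_nonneg hη.le hκt))
  set lv : ℤ → ℝ≥0∞ := fun k => 2 ^ (k : ℝ) with hlv
  have hmeas : ∀ k, Measurable ({z | lv k < 2 * κ * g z}.indicator g) := fun k =>
    hg.indicator (measurableSet_lt measurable_const (hg.const_mul _))
  have hk : ∀ k : ℤ, (2 : ℝ≥0∞) ^ (((k : ℝ) + 1) * ρ) * volume {x | lv k < localMax g x} ≤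
      ∫⁻ z, 2 ^ ρ * (2 * V) * (2 ^ ((k : ℝ) * (ρ - 1)) *
        {z | lv k < 2 * κ * g z}.indicator g z) := by
    intro k
    rw [lintegral_const_mul _ ((hmeas k).const_mul _), lintegral_const_mul _ (hmeas k)]
    have e : (2 : ℝ≥0∞) ^ (((k : ℝ) + 1) * ρ) = 2 ^ ρ * 2 ^ ((k : ℝ) * (ρ - 1)) * lv k := by
      rw [hlv, ← ENNReal.rpow_add _ _ two_ne_zero ENNReal.ofNat_ne_top,
        ← ENNReal.rpow_add _ _ two_ne_zero ENNReal.ofNat_ne_top]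
      congr 1
      ring
    rw [e, mul_assoc]
    refine (mul_le_mul' le_rfl (mul_volume_lt_localMax_le_trunc g)).trans (le_of_eq ?_)
    ring
  calc ∫⁻ x, localMax g x ^ ρ
      ≤ ∫⁻ x, ∑' k : ℤ, (toMeasurable volume {x | lv k < localMax g x}).indicator
        (fun _ => (2 : ℝ≥0∞) ^ (((k : ℝ) + 1) * ρ)) x := by
        refine lintegral_mono fun x => (rpow_le_tsum_dyadic (by linarith) _).trans ?_
        refine ENNReal.tsum_le_tsum fun k => ?_
        by_cases h : lv k < localMax g x
        · rw [indicator_of_mem (by exact h), indicator_of_mem (subset_toMeasurable volume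
            {x | lv k < localMax g x} (by exact h))]
        · rw [indicator_of_notMem (by exact h)]
          exact zero_le
    _ = ∑' k : ℤ, (2 : ℝ≥0∞) ^ (((k : ℝ) + 1) * ρ) * volume {x | lv k < localMax g x} := by
        rw [lintegral_tsum fun k =>
          (measurable_const.indicator (measurableSet_toMeasurable _ _)).aemeasurable]
        refine tsum_congr fun k => ?_
        rw [lintegral_indicator_const (measurableSet_toMeasurable _ _), measure_toMeasurable]
    _ ≤ ∑' k : ℤ, ∫⁻ z, 2 ^ ρ * (2 * V) * (2 ^ ((k : ℝ) * (ρ - 1)) *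
        {z | lv k < 2 * κ * g z}.indicator g z) := ENNReal.tsum_le_tsum hk
    _ = ∫⁻ z, 2 ^ ρ * (2 * V) * (g z * ∑' k : ℤ, {b | (2 : ℝ≥0∞) ^ (k : ℝ) < b}.indicator
          (fun _ => (2 : ℝ≥0∞) ^ ((k : ℝ) * (ρ - 1))) (2 * κ * g z)) := by
        rw [← lintegral_tsum fun k => (((hmeas k).const_mul _).const_mul _).aemeasurable]
        refine lintegral_congr fun z => ?_
        rw [ENNReal.tsum_mul_left, ← ENNReal.tsum_mul_left (a := g z)]
        congr 2
        funext k
        by_cases h : lv k < 2 * κ * g z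
        · rw [indicator_of_mem (by exact h), indicator_of_mem (by exact h), mul_comm]
        · rw [indicator_of_notMem (by exact h), indicator_of_notMem (by exact h), mul_zero, mul_zero]
    _ ≤ ∫⁻ z, 2 ^ ρ * (2 * V) * (C * (2 * κ) ^ (ρ - 1)) * g z ^ ρ := by
        refine lintegral_mono fun z => ?_
        refine (mul_le_mul' le_rfl (mul_le_mul' le_rfl (hsum _))).trans (le_of_eq ?_)
        have e : g z ^ ρ = g z ^ (ρ - 1) * g z := by
          have := ENNReal.rpow_add_of_nonneg (x := g z) _ _ hη.le zero_le_one
          rwa [sub_add_cancel, ENNReal.rpow_one] at this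
        rw [ENNReal.mul_rpow_of_nonneg _ _ hη.le, e]
        ring
    _ = _ := lintegral_const_mul _ (hg.pow_const _)

theorem TestFn.measurable_smallMax {φ : RN N → ℝ} (hφ : GoodPhi φ) (u : TestFn N) :
    Measurable (smallMax φ u) := by
  have : LowerSemicontinuous (smallMax φ u) := by
    refine lowerSemicontinuous_biSup fun t ht => Continuous.lowerSemicontinuous ?_
    simp_rw [← TestFn.avg_eq_convAt hφ ht.1]
    exact ENNReal.continuous_ofReal.comp (TestFn.continuous _).norm
  exact this.measurable

theorem TestFn.enorm_avg_le_smallMax {φ : RN N → ℝ} (hφ : GoodPhi φ) (u : TestFn N) {s : ℝ}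
    (hs : s ∈ Ioo (0 : ℝ) 1) (z : RN N) : ‖avg φ s u z‖ₑ ≤ smallMax φ u z := by
  rw [TestFn.avg_eq_convAt hφ hs.1, ← ofReal_norm]
  exact le_iSup₂ (f := fun t (_ : t ∈ Ioo (0 : ℝ) 1) => ENNReal.ofReal ‖convAt φ t u z‖) s hs

theorem ENNReal.rpow_sum_le_sum_rpow_of_le_one {ι : Type*} (s : Finset ι) (g : ι → ℝ≥0∞) {p : ℝ}
    (hp0 : 0 < p) (hp1 : p ≤ 1) : (∑ i ∈ s, g i) ^ p ≤ ∑ i ∈ s, g i ^ p := by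
  classical
  induction s using Finset.induction_on with
  | empty => simp [hp0]
  | insert a s ha ih =>
    rw [Finset.sum_insert ha, Finset.sum_insert ha]
    exact (ENNReal.rpow_add_le_add_rpow _ _ hp0.le hp1).trans (add_le_add_right ih _)

theorem ofReal_setAverage_le (s : Set (RN N)) (g : RN N → ℝ) :
    ENNReal.ofReal (⨍ y in s, g y) ≤ (volume s)⁻¹ * ∫⁻ y in s, ‖g y‖ₑ := by
  rw [setAverage_eq, smul_eq_mul]
  refine (Real.ofReal_le_enorm _).trans ?_
  rw [enorm_mul]
  refine mul_le_mul' ?_ (enorm_integral_le_lintegral_enorm _)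
  rcases eq_or_ne (volume s) ∞ with h | h
  · simp [measureReal_def, h]
  rcases eq_or_ne (volume s) 0 with h0 | h0
  · simp [h0]
  rw [measureReal_def, enorm_inv (ENNReal.toReal_ne_zero.2 ⟨h0, h⟩),
    Real.enorm_of_nonneg ENNReal.toReal_nonneg, ENNReal.ofReal_toReal h]

theorem volume_ball_eq_ofReal_pow_mul (x : RN N) {t : ℝ} (ht : 0 < t) :
    volume (ball x t) = ENNReal.ofReal (t ^ N) * volume (ball (0 : RN N) 1) := by
  rw [Measure.addHaar_ball_of_pos _ _ ht, finrank_euclideanSpace, Fintype.card_fin]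

theorem TestFn.exists_average_rpow_le {φ : RN N → ℝ} (hφ : GoodPhi φ) {m : ℕ} {q α : ℝ}
    (hq0 : 0 < q) (hq1 : q ≤ 1) (hα : 1 ≤ α) (hqm : N / q - N < m) (hδ : 0 < m - N / q + N / α) :
    ∃ C : ℝ≥0∞, C ≠ ∞ ∧ ∀ (f : TestFn N) (G : RN N → ℝ≥0∞), Measurable G →
      (∀ w : List (Fin N), w.length = m → ∀ z, ∀ s ∈ Ioo (0 : ℝ) 1,
        ‖avg φ s (DW w f) z‖ₑ ≤ G z) → ∀ x, ∀ t ∈ Ioo (0 : ℝ) 1,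
      ENNReal.ofReal (⨍ y in ball x t, ((t ^ m)⁻¹ *
        ‖f y - taylor m ((1 - osc φ t (m + 1)) f) x (y - x)‖) ^ α) ≤
      C * localMax (fun z => G z ^ q) x ^ (α / q) := by
  have hα0 : 0 < α := one_pos.trans_le hα
  obtain ⟨K, hK, hF⟩ := TestFn.exists_enorm_sub_taylor_le hφ hq0 hq1 hqm
  obtain ⟨C₁, hC₁, hG⟩ := exists_setLIntegral_tsum_mean_le (N := N) hq0 (hq1.trans hα) hδ
  set V := volume (ball (0 : RN N) 1)
  have hV0 : V ≠ 0 := (measure_ball_pos _ _ one_pos).ne'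
  have hVt : V ≠ ∞ := measure_ball_lt_top.ne
  refine ⟨ENNReal.ofReal K ^ α * C₁ * V⁻¹, ENNReal.mul_ne_top (ENNReal.mul_ne_top
    (ENNReal.rpow_ne_top_of_nonneg hα0.le ENNReal.ofReal_ne_top) hC₁) (ENNReal.inv_ne_top.2 hV0),
    fun f G hGm hw x t ht => (ofReal_setAverage_le _ _).trans ?_⟩
  have ht0 := ht.1
  have hg : Measurable fun z => G z ^ q := hGm.pow_const _
  have hint : ∫⁻ y in ball x t, ‖((t ^ m)⁻¹ *
        ‖f y - taylor m ((1 - osc φ t (m + 1)) f) x (y - x)‖) ^ α‖ₑ ≤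
      (ENNReal.ofReal (t ^ m)⁻¹ * ENNReal.ofReal K) ^ α * (C₁ * (ENNReal.ofReal (t ^ m) ^ α *
        ENNReal.ofReal (t ^ N) * localMax (fun z => G z ^ q) x ^ (α / q))) := by
    calc _ ≤ ∫⁻ y in ball x t, (ENNReal.ofReal (t ^ m)⁻¹ * ENNReal.ofReal K) ^ α *
          (∑' n : ℕ, ENNReal.ofReal ((t / 2 ^ n) ^ m) *
            mean (fun z => G z ^ q) (t / 2 ^ n) y ^ (1 / q)) ^ α := by
          refine setLIntegral_mono' measurableSet_ball fun y hy => ?_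
          rw [Real.enorm_rpow_of_nonneg (by positivity) hα0.le, enorm_mul, enorm_norm,
            Real.enorm_of_nonneg (by positivity), ← ENNReal.mul_rpow_of_nonneg _ _ hα0.le, mul_assoc]
          exact ENNReal.rpow_le_rpow (mul_le_mul' le_rfl (hF f G hw x t ht y hy)) hα0.le
      _ = (ENNReal.ofReal (t ^ m)⁻¹ * ENNReal.ofReal K) ^ α *
          ∫⁻ y in ball x t, (∑' n : ℕ, ENNReal.ofReal ((t / 2 ^ n) ^ m) *
            mean (fun z => G z ^ q) (t / 2 ^ n) y ^ (1 / q)) ^ α :=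
          lintegral_const_mul' _ _ (ENNReal.rpow_ne_top_of_nonneg hα0.le
            (ENNReal.mul_ne_top ENNReal.ofReal_ne_top ENNReal.ofReal_ne_top))
      _ ≤ _ := by
          refine mul_le_mul' le_rfl ((hG _ hg x t ht0).trans (mul_le_mul' le_rfl
            (mul_le_mul' le_rfl (ENNReal.rpow_le_rpow ?_ (by positivity)))))
          exact le_iSup₂ (f := fun r (_ : r ∈ Ioo (0 : ℝ) 1) =>
            ENNReal.ofReal (1 / r ^ N) * ∫⁻ z in closedBall x (9 * r), G z ^ q) t ht
  refine (mul_le_mul' le_rfl hint).trans (le_of_eq ?_)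
  have htN : ENNReal.ofReal (t ^ N) ≠ 0 := (ENNReal.ofReal_pos.2 (by positivity)).ne'
  have h1 : ENNReal.ofReal (t ^ m)⁻¹ ^ α * ENNReal.ofReal (t ^ m) ^ α = 1 := by
    rw [← ENNReal.mul_rpow_of_nonneg _ _ hα0.le, ← ENNReal.ofReal_mul (by positivity),
      inv_mul_cancel₀ (by positivity), ENNReal.ofReal_one, ENNReal.one_rpow]
  have h2 : (ENNReal.ofReal (t ^ N))⁻¹ * ENNReal.ofReal (t ^ N) = 1 :=
    ENNReal.inv_mul_cancel htN ENNReal.ofReal_ne_top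
  rw [volume_ball_eq_ofReal_pow_mul x ht0, ENNReal.mul_inv (Or.inl htN)
    (Or.inl ENNReal.ofReal_ne_top), ENNReal.mul_rpow_of_nonneg _ _ hα0.le]
  set L := localMax (fun z => G z ^ q) x ^ (α / q)
  calc _ = (ENNReal.ofReal (t ^ m)⁻¹ ^ α * ENNReal.ofReal (t ^ m) ^ α) *
        ((ENNReal.ofReal (t ^ N))⁻¹ * ENNReal.ofReal (t ^ N)) *
        (ENNReal.ofReal K ^ α * C₁ * V⁻¹ * L) := by ring
    _ = _ := by rw [h1, h2, one_mul, one_mul]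

/-- The sum over `|β| ≤ m` of the small maximal functions of `∂^β f`. -/
def sumMax (φ : RN N → ℝ) (m : ℕ) (f : RN N → ℂ) (z : RN N) : ℝ≥0∞ :=
  ∑ β ∈ idxLe N m, smallMax φ (md β f) z

theorem TestFn.measurable_sumMax {φ : RN N → ℝ} (hφ : GoodPhi φ) (m : ℕ) (f : TestFn N) :
    Measurable (sumMax φ m f) := by
  refine Finset.measurable_fun_sum _ fun β _ => ?_
  rw [TestFn.md_eq]
  exact TestFn.measurable_smallMax hφ _

theorem TestFn.enorm_avg_DW_le_sumMax {φ : RN N → ℝ} (hφ : GoodPhi φ) {m : ℕ} (f : TestFn N)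
    {w : List (Fin N)} (hw : w.length = m) (z : RN N) {s : ℝ} (hs : s ∈ Ioo (0 : ℝ) 1) :
    ‖avg φ s (DW w f) z‖ₑ ≤ sumMax φ m f z := by
  obtain ⟨β, hβ, h⟩ := TestFn.exists_DW_eq_md w
  rw [hw] at hβ
  refine (TestFn.enorm_avg_le_smallMax hφ _ hs z).trans ?_
  rw [h f]
  exact Finset.single_le_sum (f := fun β => smallMax φ (md β f) z) (fun _ _ => bot_le) hβ

theorem TestFn.lintegral_sumMax_rpow_le {φ : RN N → ℝ} (hφ : GoodPhi φ) (m : ℕ) {p : ℝ}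
    (hp0 : 0 < p) (hp1 : p ≤ 1) (f : TestFn N) :
    ∫⁻ z, sumMax φ m f z ^ p ≤ (idxLe N m).card * (∑ β ∈ idxLe N m, hNorm φ p (md β f)) ^ p := by
  have hmeas : ∀ β, Measurable fun z => smallMax φ (md β (f : RN N → ℂ)) z ^ p := fun β => by
    rw [TestFn.md_eq]
    exact (TestFn.measurable_smallMax hφ _).pow_const _
  calc ∫⁻ z, sumMax φ m f z ^ p
      ≤ ∫⁻ z, ∑ β ∈ idxLe N m, smallMax φ (md β f) z ^ p :=
        lintegral_mono fun z => ENNReal.rpow_sum_le_sum_rpow_of_le_one _ _ hp0 hp1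
    _ = ∑ β ∈ idxLe N m, hNorm φ p (md β f) ^ p := by
        rw [lintegral_finsetSum _ fun β _ => hmeas β]
        refine Finset.sum_congr rfl fun β _ => ?_
        rw [hNorm, ← ENNReal.rpow_mul, one_div_mul_cancel hp0.ne', ENNReal.rpow_one]
    _ ≤ ∑ _β ∈ idxLe N m, (∑ β ∈ idxLe N m, hNorm φ p (md β f)) ^ p :=
        Finset.sum_le_sum fun β hβ => ENNReal.rpow_le_rpow (Finset.single_le_sum
          (f := fun β => hNorm φ p (md β f)) (fun _ _ => bot_le) hβ) hp0.le
    _ = _ := by rw [Finset.sum_const, nsmul_eq_mul]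

theorem exists_intermediate_exponent {N m : ℕ} (hN : 1 ≤ N) (hm : 1 ≤ m) {p α : ℝ}
    (hp₁ : (N : ℝ) / (N + m) < p)  (hα₁ : 1 ≤ α) (hα₂ : (m : ℝ) * p < N → α < (N : ℝ) * p / ((N : ℝ) - m * p)) :
    ∃ q : ℝ, 0 < q ∧ q < p ∧ 0 < m - N / q + N / α ∧ N / q - N < m := by
  have hN0 : (0 : ℝ) < N := by exact_mod_cast hN
  have hm0 : (0 : ℝ) < m := by exact_mod_cast hm
  have hα0 : 0 < α := one_pos.trans_le hα₁
  have hp0 : 0 < p := (by positivity : (0 : ℝ) < N / (N + m)).trans hp₁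
  have hNα : 0 < N / α := by positivity
  have hNα' : N / α ≤ N := div_le_self hN0.le hα₁
  have key : N / p < m + N / α := by
    rcases lt_or_ge ((m : ℝ) * p) N with h | h
    · have h1 := hα₂ h
      have h2 : 0 < (N : ℝ) - m * p := by linarith
      rw [lt_div_iff₀ h2] at h1
      rw [div_lt_iff₀ hp0, add_mul, div_mul_eq_mul_div, ← sub_lt_iff_lt_add', lt_div_iff₀ hα0]
      linarith
    · have : N / p ≤ m := by rwa [div_le_iff₀ hp0]
      linarith
  set e : ℝ := (N / p + (m + N / α)) / 2 with he
  have hNp : 0 < N / p := by positivity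
  have he0 : 0 < e := by positivity
  have hq : N / (N / e) = e := div_div_cancel₀ hN0.ne'
  refine ⟨N / e, by positivity, ?_, ?_, ?_⟩
  · rw [div_lt_comm₀ he0 hp0]
    linarith
  · rw [hq]
    linarith
  · rw [hq]
    linarith

theorem continuousOn_Ioo_of_continuous_Ioi {F : RN N → ℝ → RN N → ℂ}
    (hF : Continuous fun z : (RN N × Ioi (0 : ℝ)) × RN N => F z.1.1 z.1.2 z.2) :
    ContinuousOn (fun z : (RN N × ℝ) × RN N => F z.1.1 z.1.2 z.2)
      ((univ ×ˢ Ioo (0 : ℝ) 1) ×ˢ univ) := by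
  rw [continuousOn_iff_continuous_domRestrict]
  have hg : Continuous fun z : ((univ ×ˢ Ioo (0 : ℝ) 1) ×ˢ univ : Set ((RN N × ℝ) × RN N)) =>
      (((z.1.1.1, ⟨z.1.1.2, z.2.1.2.1⟩), z.1.2) : (RN N × Ioi (0 : ℝ)) × RN N) := by
    fun_prop
  exact hF.comp hg

/-- Lemma 6.1 (main Poincaré-type inequality on Hardy–Sobolev spaces), case
`N/(N+m) < p ≤ min{1, N/m}`. -/
theorem statement12 {N m : ℕ} (hN : 1 ≤ N) (hm : 1 ≤ m) (p α : ℝ)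
    (hp₁ : (N : ℝ) / (N + m) < p) (hp₂ : p ≤ min 1 ((N : ℝ) / m))
    (hα₁ : 1 ≤ α) (hα₂ : (m : ℝ) * p < N → α < (N : ℝ) * p / ((N : ℝ) - m * p))
    (φ₀ : RN N → ℝ) (hφ₀ : GoodPhi φ₀) :
    ∃ C : ℝ, 0 < C ∧
      ∀ f : RN N → ℂ, ContDiff ℝ (⊤ : ℕ∞) f → HasCompactSupport f →
        ∃ P : RN N → ℝ → RN N → ℂ,
          (∀ x t, IsPolyDegLE N (m - 1) (P x t)) ∧
          ContinuousOn (fun z : (RN N × ℝ) × RN N => P z.1.1 z.1.2 z.2)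
            ((univ ×ˢ Ioo (0 : ℝ) 1) ×ˢ univ) ∧
          ∫⁻ x, (⨆ t ∈ Ioo (0 : ℝ) 1,
              ENNReal.ofReal (⨍ y in ball x t, ((t ^ m)⁻¹ * ‖f y - P x t y‖) ^ α)) ^ (p / α)
            ≤ ENNReal.ofReal C * (∑ β ∈ idxLe N m, hNorm φ₀ p (md β f)) ^ p := by
  obtain ⟨q, hq0, hqp, hδ, hqm⟩ := exists_intermediate_exponent hN hm hp₁ hα₁ hα₂
  have hp0 : 0 < p := hq0.trans hqp
  have hp1 : p ≤ 1 := hp₂.trans (min_le_left _ _)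
  have hα0 : 0 < α := one_pos.trans_le hα₁
  have hpα : 0 ≤ p / α := by positivity
  obtain ⟨C₁, hC₁, h₁⟩ :=
    TestFn.exists_average_rpow_le hφ₀ hq0 (hqp.le.trans hp1) hα₁ hqm hδ
  obtain ⟨C₂, hC₂, h₂⟩ :=
    exists_lintegral_localMax_rpow_le (N := N) (ρ := p / q) ((one_lt_div hq0).2 hqp)
  have hC : C₁ ^ (p / α) * C₂ * (idxLe N m).card ≠ ∞ := ENNReal.mul_ne_top
    (ENNReal.mul_ne_top (ENNReal.rpow_ne_top_of_nonneg hpα hC₁) hC₂) (ENNReal.natCast_ne_top _)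
  refine ⟨(C₁ ^ (p / α) * C₂ * (idxLe N m).card).toReal + 1,
    add_pos_of_nonneg_of_pos ENNReal.toReal_nonneg one_pos, fun f hf hfc => ?_⟩
  set u : TestFn N := ⟨f, hf, hfc⟩
  refine ⟨fun x t y => TestFn.taylor m ((1 - TestFn.osc φ₀ t (m + 1)) u) x (y - x),
    fun x t => TestFn.isPolyDegLE_taylor _ _ _, ?_, ?_⟩
  · exact continuousOn_Ioo_of_continuous_Ioi
      (F := fun x t y => TestFn.taylor m ((1 - TestFn.osc φ₀ t (m + 1)) u) x (y - x))
      (TestFn.continuous_taylor_osc hφ₀ (m + 1) m u)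
  have hG := TestFn.measurable_sumMax hφ₀ m u
  have h₃ := h₁ u _ hG fun w hw z s hs => TestFn.enorm_avg_DW_le_sumMax hφ₀ u hw z hs
  calc _ ≤ ∫⁻ x, C₁ ^ (p / α) * localMax (fun z => sumMax φ₀ m f z ^ q) x ^ (p / q) := by
        refine lintegral_mono fun x =>
          (ENNReal.rpow_le_rpow (iSup₂_le fun t ht => h₃ x t ht) hpα).trans (le_of_eq ?_)
        rw [ENNReal.mul_rpow_of_nonneg _ _ hpα, ← ENNReal.rpow_mul]
        congr 2
        field_simp
    _ = C₁ ^ (p / α) * ∫⁻ x, localMax (fun z => sumMax φ₀ m f z ^ q) x ^ (p / q) :=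
        lintegral_const_mul' _ _ (ENNReal.rpow_ne_top_of_nonneg hpα hC₁)
    _ ≤ C₁ ^ (p / α) * (C₂ * ∫⁻ x, (sumMax φ₀ m f x ^ q) ^ (p / q)) :=
        mul_le_mul' le_rfl (h₂ _ (hG.pow_const q))
    _ = C₁ ^ (p / α) * (C₂ * ∫⁻ x, sumMax φ₀ m f x ^ p) := by
        simp_rw [← ENNReal.rpow_mul, mul_div_cancel₀ p hq0.ne']
    _ ≤ C₁ ^ (p / α) * (C₂ * ((idxLe N m).card *
          (∑ β ∈ idxLe N m, hNorm φ₀ p (md β f)) ^ p)) :=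
        mul_le_mul' le_rfl (mul_le_mul' le_rfl
          (TestFn.lintegral_sumMax_rpow_le hφ₀ m hp0 hp1 u))
    _ = C₁ ^ (p / α) * C₂ * (idxLe N m).card *
          (∑ β ∈ idxLe N m, hNorm φ₀ p (md β f)) ^ p := by ring
    _ ≤ _ := by
        refine mul_le_mul' ?_ le_rfl
        rw [ENNReal.ofReal_add ENNReal.toReal_nonneg zero_le_one, ENNReal.ofReal_toReal hC]
        exact le_self_add
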